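/- arXiv:2009.10754 — 6 statements merged into one kernel-verified Lean document; each statement's English description precedes it below -/
import Mathlib

section
/- There is a constant C > 0 such that the following holds. For every n, m ≥ 1, every norm ‖·‖ on ℝ^m, and every function f : {-1,1}^n → ℝ^m, if X is uniformly distributed in {-1,1}^n then (E[‖Rad f(X)‖²])^{1/2} ≤ C·log(m+1)·(E[‖f(X)‖²])^{1/2}. -/
open Finset Real

noncomputable section

/-- The discrete cube `{-1,1}^n` as a finite set of points of `ℝ^n`. -/
def cube (n : ℕ) : Finset (Fin n → ℝ) :=
  Fintype.piFinset fun _ => ({-1, 1} : Finset ℝ)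

/-- Expectation of `g(X)` for `X` uniform on the discrete cube `{-1,1}^n`. -/
def cubeAvg (n : ℕ) (g : (Fin n → ℝ) → ℝ) : ℝ :=
  (∑ x ∈ cube n, g x) / (2 : ℝ) ^ n

/-- Fourier coefficient `f̂(S) = E[f(X)·χ_S(X)]` of a (vector-valued) function on the cube. -/
def cubeFourier {E : Type*} [AddCommGroup E] [Module ℝ E]
    (n : ℕ) (f : (Fin n → ℝ) → E) (S : Finset (Fin n)) : E :=
  (((2 : ℝ) ^ n)⁻¹) • ∑ x ∈ cube n, (∏ j ∈ S, x j) • f x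

/-- The Rademacher projection (linear part) `Rad f(x) = Σ_j f̂({j})·x_j`. -/
def rad {E : Type*} [AddCommGroup E] [Module ℝ E]
    (n : ℕ) (f : (Fin n → ℝ) → E) (x : Fin n → ℝ) : E :=
  ∑ j : Fin n, x j • cubeFourier n f {j}

theorem sum_exp_int_mul_two_pi_div {M : ℕ} (hM : 0 < M) (l : ℤ) (hl : |l| < M) :
    ∑ j ∈ range M, Complex.exp (l * ((2 * π * j / M : ℝ) : ℂ) * Complex.I) =
      if l = 0 then (M : ℂ) else 0 := by
  split_ifs with h
  · simp [h]
  have hM' : (M : ℂ) ≠ 0 := by exact_mod_cast hM.ne'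
  have hterm : ∀ j ∈ range M, Complex.exp (l * ((2 * π * j / M : ℝ) : ℂ) * Complex.I) =
      Complex.exp (l * (2 * π / M) * Complex.I) ^ j := fun j _ => by
    rw [← Complex.exp_nat_mul]
    push_cast
    ring_nf
  rw [sum_congr rfl hterm, geom_sum_eq]
  · rw [← Complex.exp_nat_mul, Complex.exp_eq_one_iff.mpr ⟨l, by field_simp⟩]
    simp
  · intro h1
    obtain ⟨q, hq⟩ := Complex.exp_eq_one_iff.mp h1
    have hpi : (2 * π * Complex.I : ℂ) ≠ 0 := Complex.two_pi_I_ne_zero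
    have : (l : ℂ) = q * M := by
      field_simp at hq
      have h2 : (2 * π * Complex.I : ℂ) * l = (2 * π * Complex.I) * (q * M) := by
        linear_combination (2 * π * Complex.I : ℂ) * hq
      exact mul_left_cancel₀ hpi h2
    have hlq : l = q * M := by exact_mod_cast this
    exact h (Int.eq_zero_of_abs_lt_dvd ⟨q, by rw [hlq, mul_comm]⟩ hl)

/-- `N` times the Fejér kernel of order `N`. -/
def fejerSum (N : ℕ) (θ : ℝ) : ℝ :=
  Complex.normSq (∑ a ∈ range N, Complex.exp (a * θ * Complex.I))

theorem fejerSum_nonneg (N : ℕ) (θ : ℝ) : 0 ≤ fejerSum N θ := Complex.normSq_nonneg _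

theorem fejerSum_eq (N : ℕ) (θ : ℝ) :
    (fejerSum N θ : ℂ) =
      ∑ a ∈ range N, ∑ b ∈ range N, Complex.exp (((a - b : ℤ) : ℂ) * θ * Complex.I) := by
  rw [fejerSum, ← Complex.mul_conj, map_sum, sum_mul_sum]
  refine sum_congr rfl fun a _ => sum_congr rfl fun b _ => ?_
  rw [← Complex.exp_conj, ← Complex.exp_add]
  congr 1
  simp
  ring

theorem sum_fejerSum {M N : ℕ} (hM : 0 < M) (hNM : N ≤ M) :
    ∑ j ∈ range M, fejerSum N (2 * π * j / M) = M * N := by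
  have h : (∑ j ∈ range M, (fejerSum N (2 * π * j / M) : ℂ)) = M * N := by
    simp_rw [fejerSum_eq]
    rw [sum_comm]
    simp_rw [sum_comm (s := range M)]
    have : ∀ a ∈ range N, ∑ b ∈ range N, ∑ j ∈ range M,
        Complex.exp (((a - b : ℤ) : ℂ) * ((2 * π * j / M : ℝ) : ℂ) * Complex.I) = M := by
      intro a ha
      rw [sum_eq_single a]
      · rw [sum_exp_int_mul_two_pi_div hM _ (by simpa using hM)]
        simp
      · intro b hb hab
        rw [sum_exp_int_mul_two_pi_div hM, if_neg]
        · omega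
        · rw [mem_range] at ha hb
          rw [abs_lt]; omega
      · exact fun h => absurd ha h
    rw [sum_congr rfl this]
    simp [mul_comm]
  exact_mod_cast h

/-- Discrete convolution against `2 N sin(N θ)` times the Fejér kernel differentiates
trigonometric polynomials of degree at most `N` at the origin. -/
theorem sum_fejerSum_mul_exp {N : ℕ} (hN : 0 < N) (k : ℤ) (hk : |k| ≤ N) :
    ∑ j ∈ range (3 * N),
      ((2 / (3 * N : ℕ) * sin (N * (2 * π * j / (3 * N : ℕ))) *
        fejerSum N (2 * π * j / (3 * N : ℕ)) : ℝ) : ℂ) *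
        Complex.exp (k * ((2 * π * j / (3 * N : ℕ) : ℝ) : ℂ) * Complex.I) = k * Complex.I := by
  set M := 3 * N
  have hM : 0 < M := by omega
  have hM' : (M : ℂ) ≠ 0 := by exact_mod_cast hM.ne'
  have key : ∀ θ : ℝ, ((2 / M * sin (N * θ) * fejerSum N θ : ℝ) : ℂ) *
      Complex.exp (k * (θ : ℂ) * Complex.I) = ∑ a ∈ range N, ∑ b ∈ range N,
        Complex.I / M * (Complex.exp (((a - b + k - N : ℤ) : ℂ) * θ * Complex.I) -
          Complex.exp (((a - b + k + N : ℤ) : ℂ) * θ * Complex.I)) := by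
    intro θ
    push_cast
    rw [fejerSum_eq, Complex.sin, mul_sum, sum_mul]
    refine sum_congr rfl fun a _ => ?_
    rw [mul_sum, sum_mul]
    refine sum_congr rfl fun b _ => ?_
    have e1 : Complex.exp (((a : ℂ) - b + k - N) * θ * Complex.I) =
        Complex.exp (-(N * θ) * Complex.I) * Complex.exp (((a - b : ℤ) : ℂ) * θ * Complex.I) *
          Complex.exp (k * (θ : ℂ) * Complex.I) := by
      rw [← Complex.exp_add, ← Complex.exp_add]
      congr 1; push_cast; ring
    have e2 : Complex.exp (((a : ℂ) - b + k + N) * θ * Complex.I) =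
        Complex.exp (N * θ * Complex.I) * Complex.exp (((a - b : ℤ) : ℂ) * θ * Complex.I) *
          Complex.exp (k * (θ : ℂ) * Complex.I) := by
      rw [← Complex.exp_add, ← Complex.exp_add]
      congr 1; push_cast; ring
    rw [e1, e2]
    ring
  simp_rw [key]
  rw [sum_comm]
  simp_rw [sum_comm (s := range M), ← mul_sum, sum_sub_distrib]
  have hk' := abs_le.mp hk
  have h1 : ∀ a ∈ range N, ∑ b ∈ range N, ∑ j ∈ range M,
      Complex.exp (((a - b + k - N : ℤ) : ℂ) * ((2 * π * j / M : ℝ) : ℂ) * Complex.I) =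
        if (N : ℤ) ≤ a + k then (M : ℂ) else 0 := by
    intro a ha
    rw [mem_range] at ha
    have : ∀ b ∈ range N, ∑ j ∈ range M,
        Complex.exp (((a - b + k - N : ℤ) : ℂ) * ((2 * π * j / M : ℝ) : ℂ) * Complex.I) =
        if b = (a + k - N).toNat then (if (N : ℤ) ≤ a + k then (M : ℂ) else 0) else 0 := by
      intro b hb
      rw [mem_range] at hb
      rw [sum_exp_int_mul_two_pi_div hM _ (by rw [abs_lt]; omega), ← ite_and]
      exact if_congr (by omega) rfl rfl
    rw [sum_congr rfl this, sum_ite_eq', if_pos]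
    rw [mem_range]; omega
  have h2 : ∀ a ∈ range N, ∑ b ∈ range N, ∑ j ∈ range M,
      Complex.exp (((a - b + k + N : ℤ) : ℂ) * ((2 * π * j / M : ℝ) : ℂ) * Complex.I) =
        if a + k < 0 then (M : ℂ) else 0 := by
    intro a ha
    rw [mem_range] at ha
    have : ∀ b ∈ range N, ∑ j ∈ range M,
        Complex.exp (((a - b + k + N : ℤ) : ℂ) * ((2 * π * j / M : ℝ) : ℂ) * Complex.I) =
        if b = min (a + k + N).toNat (N - 1) then (if a + k < 0 then (M : ℂ) else 0) else 0 := by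
      intro b hb
      rw [mem_range] at hb
      rw [sum_exp_int_mul_two_pi_div hM _ (by rw [abs_lt]; omega), ← ite_and]
      exact if_congr (by omega) rfl rfl
    rw [sum_congr rfl this, sum_ite_eq', if_pos]
    rw [mem_range]; omega
  rw [sum_congr rfl h1, sum_congr rfl h2, ← sum_filter, ← sum_filter, sum_const, sum_const]
  have c1 : #((range N).filter fun a : ℕ => (N : ℤ) ≤ a + k) = k.toNat := by
    have : ((range N).filter fun a : ℕ => (N : ℤ) ≤ a + k) = Ico (N - k.toNat) N := by
      ext a; simp; omega
    rw [this, Nat.card_Ico]; omega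
  have c2 : #((range N).filter fun a : ℕ => (a : ℤ) + k < 0) = (-k).toNat := by
    have : ((range N).filter fun a : ℕ => (a : ℤ) + k < 0) = range (-k).toNat := by
      ext a; simp; omega
    rw [this, card_range]
  have hc : ((k.toNat : ℤ) : ℂ) - ((-k).toNat : ℤ) = k := by
    rw [← Int.cast_sub]; congr 1; omega
  rw [c1, c2, nsmul_eq_mul, nsmul_eq_mul, ← sub_mul]
  push_cast at hc
  rw [hc]
  field_simp

/-- A quadrature formula on `[-1, 1]` computing `p'(0)` for all polynomials `p` of degree at most
`N`, with total weight at most `2 N`. -/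
theorem exists_quadrature_deriv_zero {N : ℕ} (hN : 0 < N) :
    ∃ (M : ℕ) (w ρ : ℕ → ℝ), (∀ j, |ρ j| ≤ 1) ∧ (∑ j ∈ range M, |w j| ≤ 2 * N) ∧
      ∀ k ≤ N, ∑ j ∈ range M, w j * ρ j ^ k = if k = 1 then 1 else 0 := by
  have hM : 0 < 3 * N := by omega
  have hMR : (0 : ℝ) < (3 * N : ℕ) := by exact_mod_cast hM
  refine ⟨3 * N, fun j => 2 / (3 * N : ℕ) * sin (N * (2 * π * j / (3 * N : ℕ))) *
        fejerSum N (2 * π * j / (3 * N : ℕ)), fun j => sin (2 * π * j / (3 * N : ℕ)),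
        fun j => abs_sin_le_one _, ?_, ?_⟩
  · calc _ ≤ ∑ j ∈ range (3 * N), 2 / (3 * N : ℕ) * fejerSum N (2 * π * j / (3 * N : ℕ)) := by
          refine sum_le_sum fun j _ => ?_
          rw [abs_mul, abs_mul, abs_of_nonneg (fejerSum_nonneg _ _),
            abs_of_pos (show 0 < 2 / ((3 * N : ℕ) : ℝ) by positivity)]
          refine mul_le_mul_of_nonneg_right ?_ (fejerSum_nonneg _ _)
          exact mul_le_of_le_one_right (by positivity) (abs_sin_le_one _)
      _ = 2 * N := by
          rw [← mul_sum, sum_fejerSum hM (by omega)]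
          field_simp
  · intro k hk
    have expand : ∀ θ : ℝ, Complex.sin θ ^ k = ∑ l ∈ range (k + 1),
        ((Complex.I / 2) ^ k * (-1) ^ (k - l) * k.choose l) *
          Complex.exp (((k - 2 * l : ℤ) : ℂ) * θ * Complex.I) := by
      intro θ
      rw [Complex.sin, mul_div_assoc, mul_pow, sub_eq_add_neg, add_pow, sum_mul]
      refine sum_congr rfl fun l hl => ?_
      have hl' : l ≤ k := by simpa [Nat.lt_succ_iff] using hl
      rw [neg_pow (Complex.exp _), ← Complex.exp_nat_mul, ← Complex.exp_nat_mul]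
      have : Complex.exp (((k - 2 * l : ℤ) : ℂ) * θ * Complex.I) =
          Complex.exp (l * (-θ * Complex.I)) * Complex.exp ((k - l : ℕ) * (θ * Complex.I)) := by
        rw [← Complex.exp_add]
        congr 1; push_cast [hl']; ring
      rw [this]
      ring
    have hd1 : HasDerivAt (fun θ : ℝ => Complex.sin θ ^ k) (if k = 1 then 1 else 0) 0 := by
      have h := ((Complex.hasDerivAt_sin ((0 : ℝ) : ℂ)).comp_ofReal).pow k
      refine h.congr_deriv ?_
      rcases k with _ | _ | k <;> simp
    have hd2 : HasDerivAt (fun θ : ℝ => Complex.sin θ ^ k) (∑ l ∈ range (k + 1),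
        ((Complex.I / 2) ^ k * (-1) ^ (k - l) * k.choose l) *
          (((k - 2 * l : ℤ) : ℂ) * Complex.I)) 0 := by
      simp_rw [expand]
      refine HasDerivAt.fun_sum fun l _ => HasDerivAt.const_mul _ ?_
      have h : HasDerivAt (fun z : ℂ => Complex.exp (((k - 2 * l : ℤ) : ℂ) * z * Complex.I))
          (((k - 2 * l : ℤ) : ℂ) * Complex.I) ((0 : ℝ) : ℂ) := by
        have h0 := (((hasDerivAt_id ((0 : ℝ) : ℂ)).const_mul ((k - 2 * l : ℤ) : ℂ)).mul_const
          Complex.I).cexp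
        simpa using h0
      exact h.comp_ofReal
    have main : ∑ j ∈ range (3 * N),
      ((2 / (3 * N : ℕ) * sin (N * (2 * π * j / (3 * N : ℕ))) *
        fejerSum N (2 * π * j / (3 * N : ℕ)) : ℝ) : ℂ) *
        Complex.sin ((2 * π * j / (3 * N : ℕ) : ℝ) : ℂ) ^ k = if k = 1 then 1 else 0 := by
      rw [← hd2.unique hd1]
      simp_rw [expand, mul_sum]
      rw [sum_comm]
      refine sum_congr rfl fun l hl => ?_
      rw [mem_range] at hl
      rw [← sum_fejerSum_mul_exp hN (k - 2 * l) (by rw [abs_le]; omega), mul_sum]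
      exact sum_congr rfl fun j _ => by ring
    apply Complex.ofReal_injective
    rw [Complex.ofReal_sum]
    convert main using 2 with j
    · push_cast; rfl
    · split_ifs <;> simp

/-- **Auerbach's lemma.** -/
theorem exists_auerbach_basis {E : Type*} [NormedAddCommGroup E] [NormedSpace ℝ E]
    [FiniteDimensional ℝ E] {m : ℕ} (hm : Module.finrank ℝ E = m) :
    ∃ b : Module.Basis (Fin m) ℝ E, (∀ i, ‖b i‖ ≤ 1) ∧ ∀ x i, |b.repr x i| ≤ ‖x‖ := by
  have b₀ := Module.finBasisOfFinrankEq ℝ E hm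
  have : ProperSpace E := FiniteDimensional.proper ℝ E
  have hK : IsCompact (Set.univ.pi fun _ : Fin m => Metric.closedBall (0 : E) 1) :=
    isCompact_univ_pi fun _ => isCompact_closedBall _ _
  have hcont : Continuous fun v : Fin m → E => |b₀.det v| := by
    simp_rw [Module.Basis.det_apply]
    refine (Continuous.matrix_det (continuous_matrix fun i j => ?_)).abs
    exact (b₀.coord i).continuous_of_finiteDimensional.comp (continuous_apply j)
  obtain ⟨v, hv, hmax⟩ := hK.exists_isMaxOn ⟨0, by simp⟩ hcont.continuousOn
  have hmem : ∀ u : Fin m → E, (∀ i, ‖u i‖ ≤ 1) → |b₀.det u| ≤ |b₀.det v| := fun u hu =>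
    hmax (by simpa using hu)
  have hv1 : ∀ i, ‖v i‖ ≤ 1 := by simpa using hv
  have hpos : 0 < |b₀.det v| := by
    refine lt_of_lt_of_le ?_ (hmem (fun i => ‖b₀ i‖⁻¹ • b₀ i) fun i => ?_)
    · rw [AlternatingMap.map_smul_univ, b₀.det_self, abs_pos, smul_eq_mul, mul_one]
      exact prod_ne_zero_iff.mpr fun i _ => inv_ne_zero (norm_ne_zero_iff.mpr (b₀.ne_zero i))
    · rw [norm_smul, norm_inv, norm_norm, inv_mul_cancel₀ (norm_ne_zero_iff.mpr (b₀.ne_zero i))]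
  obtain ⟨hli, hsp⟩ := (b₀.is_basis_iff_det).mpr (isUnit_iff_ne_zero.mpr (abs_pos.mp hpos))
  set b := Module.Basis.mk hli hsp.ge
  have hbv : ⇑b = v := Module.Basis.coe_mk _ _
  refine ⟨b, fun i => by rw [hbv]; exact hv1 i, fun x i => ?_⟩
  have hdet : b₀.det (Function.update v i x) = b.repr x i * b₀.det v := by
    conv_lhs => rw [← b.sum_repr x, AlternatingMap.map_update_sum]
    rw [sum_eq_single i]
    · rw [AlternatingMap.map_update_smul, hbv, Function.update_eq_self, smul_eq_mul]
    · intro j _ hj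
      rw [AlternatingMap.map_update_smul, hbv, AlternatingMap.map_update_self _ _ hj.symm,
        smul_zero]
    · simp
  rcases eq_or_ne x 0 with rfl | hx
  · simp
  have hx' : 0 < ‖x‖ := norm_pos_iff.mpr hx
  have h := hmem (Function.update v i (‖x‖⁻¹ • x)) fun j => by
    rcases eq_or_ne j i with rfl | hj
    · simp [norm_smul, hx'.ne']
    · simpa [hj] using hv1 j
  rw [AlternatingMap.map_update_smul, hdet, smul_eq_mul, abs_mul, abs_mul, ← mul_assoc,
    abs_of_pos (inv_pos.mpr hx')] at h
  have h2 := le_of_mul_le_mul_right (h.trans_eq (one_mul _).symm) hpos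
  rwa [inv_mul_le_iff₀ hx', mul_one] at h2

theorem sq_eq_one_of_mem_cube {n : ℕ} {x : Fin n → ℝ} (hx : x ∈ cube n) (i : Fin n) :
    x i ^ 2 = 1 := by
  have h := Fintype.mem_piFinset.mp hx i
  rw [mem_insert, mem_singleton] at h
  rcases h with h | h <;> simp [h]

theorem sum_cube_prod {n : ℕ} (g : Fin n → ℝ → ℝ) :
    ∑ x ∈ cube n, ∏ j, g j (x j) = ∏ j, (g j (-1) + g j 1) := by
  rw [cube, ← prod_univ_sum]
  exact prod_congr rfl fun j _ => sum_pair (by norm_num)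

theorem sum_cube_walsh_mul_walsh {n : ℕ} (S T : Finset (Fin n)) :
    ∑ x ∈ cube n, (∏ j ∈ S, x j) * (∏ j ∈ T, x j) = if S = T then (2 : ℝ) ^ n else 0 := by
  have h : ∀ x : Fin n → ℝ, (∏ j ∈ S, x j) * (∏ j ∈ T, x j) =
      ∏ j, ((if j ∈ S then x j else 1) * (if j ∈ T then x j else 1)) := fun x => by
    rw [prod_mul_distrib, prod_ite_mem, prod_ite_mem, univ_inter, univ_inter]
  simp_rw [h]
  rw [sum_cube_prod fun j t => (if j ∈ S then t else 1) * (if j ∈ T then t else 1)]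
  split_ifs with hST
  · subst hST
    rw [prod_congr rfl (g := fun _ => (2 : ℝ))]
    · simp
    · intro j _; split_ifs <;> norm_num
  · obtain ⟨j, hj⟩ := not_forall.mp (mt Finset.ext hST)
    refine prod_eq_zero (mem_univ j) ?_
    by_cases h1 : j ∈ S <;> by_cases h2 : j ∈ T <;> simp_all

theorem sum_cube_sum_walsh_sq {n : ℕ} (a : Finset (Fin n) → ℝ) :
    ∑ x ∈ cube n, (∑ S, a S * ∏ j ∈ S, x j) ^ 2 = 2 ^ n * ∑ S, a S ^ 2 := by
  have h : ∀ x : Fin n → ℝ, (∑ S, a S * ∏ j ∈ S, x j) ^ 2 =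
      ∑ S, ∑ T, a S * a T * ((∏ j ∈ S, x j) * ∏ j ∈ T, x j) := fun x => by
    rw [sq, sum_mul_sum]
    exact sum_congr rfl fun S _ => sum_congr rfl fun T _ => by ring
  simp_rw [h]
  rw [sum_comm]
  simp_rw [sum_comm (s := cube n), ← mul_sum, sum_cube_walsh_mul_walsh]
  simp only [mul_ite, mul_zero, sum_ite_eq, mem_univ, if_true]
  rw [mul_sum]
  exact sum_congr rfl fun S _ => by ring

/-- Bessel's inequality for the Walsh system. -/
theorem sum_cubeFourier_sq_le {n : ℕ} (h : (Fin n → ℝ) → ℝ) :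
    2 ^ n * ∑ S, cubeFourier n h S ^ 2 ≤ ∑ x ∈ cube n, h x ^ 2 := by
  have hc : ∀ S, ∑ x ∈ cube n, h x * ∏ j ∈ S, x j = 2 ^ n * cubeFourier n h S := fun S => by
    rw [cubeFourier, smul_eq_mul, ← mul_assoc, mul_inv_cancel₀ (by positivity), one_mul]
    exact sum_congr rfl fun x _ => by rw [smul_eq_mul, mul_comm]
  have hcross : ∑ x ∈ cube n, h x * ∑ S, cubeFourier n h S * ∏ j ∈ S, x j =
      2 ^ n * ∑ S, cubeFourier n h S ^ 2 := by
    simp_rw [mul_sum]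
    rw [sum_comm]
    refine sum_congr rfl fun S _ => ?_
    rw [sq, ← mul_assoc, ← hc S, sum_mul]
    exact sum_congr rfl fun x _ => by ring
  have hpos : 0 ≤ ∑ x ∈ cube n, (h x - ∑ S, cubeFourier n h S * ∏ j ∈ S, x j) ^ 2 :=
    sum_nonneg fun _ _ => sq_nonneg _
  simp_rw [sub_sq, sum_add_distrib, sum_sub_distrib, mul_assoc, ← mul_sum] at hpos
  rw [hcross, sum_cube_sum_walsh_sq] at hpos
  linarith

theorem sum_cube_multiplier_sq_le {n : ℕ} (h : (Fin n → ℝ) → ℝ) (c : Finset (Fin n) → ℝ) {δ : ℝ}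
    (hc : ∀ S, |c S| ≤ δ) :
    ∑ x ∈ cube n, (∑ S, (c S * ∏ j ∈ S, x j) * cubeFourier n h S) ^ 2 ≤
      δ ^ 2 * ∑ x ∈ cube n, h x ^ 2 := by
  have e : ∀ x : Fin n → ℝ, ∑ S, (c S * ∏ j ∈ S, x j) * cubeFourier n h S =
      ∑ S, (c S * cubeFourier n h S) * ∏ j ∈ S, x j := fun x =>
    sum_congr rfl fun S _ => by ring
  simp_rw [e]
  rw [sum_cube_sum_walsh_sq]
  calc _ ≤ 2 ^ n * ∑ S, δ ^ 2 * cubeFourier n h S ^ 2 := by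
        gcongr with S _
        rw [mul_pow]
        gcongr ?_ * _
        exact sq_le_sq' (neg_le_of_abs_le (hc S)) (le_of_abs_le (hc S))
    _ = δ ^ 2 * (2 ^ n * ∑ S, cubeFourier n h S ^ 2) := by rw [← mul_sum]; ring
    _ ≤ _ := by gcongr; exact sum_cubeFourier_sq_le h

theorem norm_sum_smul_sq_le {ι E : Type*} [SeminormedAddCommGroup E] [NormedSpace ℝ E]
    (s : Finset ι) (w : ι → ℝ) (v : ι → E) :
    ‖∑ i ∈ s, w i • v i‖ ^ 2 ≤ (∑ i ∈ s, |w i|) * ∑ i ∈ s, |w i| * ‖v i‖ ^ 2 := by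
  calc _ ≤ (∑ i ∈ s, |w i| * ‖v i‖) ^ 2 := by
        gcongr
        exact (norm_sum_le _ _).trans_eq (sum_congr rfl fun i _ => norm_smul _ _)
    _ ≤ _ := by
        refine sum_sq_le_sum_mul_sum_of_sq_le_mul s (fun _ _ => abs_nonneg _)
          (fun _ _ => by positivity) fun i _ => le_of_eq (by ring)

/-- In dimension `m`, a Fourier multiplier bounded by `δ` has norm at most `m * δ`. -/
theorem sum_cube_norm_multiplier_sq_le {E : Type*} [NormedAddCommGroup E] [NormedSpace ℝ E]
    [FiniteDimensional ℝ E] {n m : ℕ} (hm : Module.finrank ℝ E = m)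
    (f : (Fin n → ℝ) → E) (c : Finset (Fin n) → ℝ) {δ : ℝ} (hc : ∀ S, |c S| ≤ δ) :
    ∑ x ∈ cube n, ‖∑ S, (c S * ∏ j ∈ S, x j) • cubeFourier n f S‖ ^ 2 ≤
      (m * δ) ^ 2 * ∑ x ∈ cube n, ‖f x‖ ^ 2 := by
  obtain ⟨b, hb, hrepr⟩ := exists_auerbach_basis hm
  have hcoord : ∀ i S, b.coord i (cubeFourier n f S) =
      cubeFourier n (fun x => b.coord i (f x)) S := fun i S => by
    simp only [cubeFourier, map_smul, map_sum]
  have hnorm : ∀ v : E, ‖v‖ ^ 2 ≤ m * ∑ i, b.coord i v ^ 2 := fun v => by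
    calc ‖v‖ ^ 2 ≤ (∑ i, |b.coord i v|) ^ 2 := by
          gcongr
          conv_lhs => rw [← b.sum_repr v]
          refine (norm_sum_le _ _).trans (sum_le_sum fun i _ => ?_)
          rw [norm_smul, norm_eq_abs]
          exact mul_le_of_le_one_right (abs_nonneg _) (hb i)
      _ ≤ _ := by
          refine sq_sum_le_card_mul_sum_sq.trans_eq ?_
          simp
  calc _ ≤ ∑ x ∈ cube n, m * ∑ i, (b.coord i
          (∑ S, (c S * ∏ j ∈ S, x j) • cubeFourier n f S)) ^ 2 :=
        sum_le_sum fun x _ => hnorm _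
    _ = m * ∑ i, ∑ x ∈ cube n, (∑ S, (c S * ∏ j ∈ S, x j) *
          cubeFourier n (fun x => b.coord i (f x)) S) ^ 2 := by
        rw [← mul_sum, sum_comm]
        simp only [map_sum, map_smul, hcoord, smul_eq_mul]
    _ ≤ m * ∑ _i : Fin m, δ ^ 2 * ∑ x ∈ cube n, ‖f x‖ ^ 2 := by
        gcongr with i _
        refine (sum_cube_multiplier_sq_le _ c hc).trans ?_
        refine mul_le_mul_of_nonneg_left (sum_le_sum fun x _ => ?_) (sq_nonneg _)
        rw [← sq_abs]
        exact pow_le_pow_left₀ (abs_nonneg _) (hrepr _ _) 2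
    _ = _ := by
        rw [sum_const, card_univ, Fintype.card_fin, nsmul_eq_mul]
        ring

/-- The kernel of the noise operator on the cube. -/
def noiseKernel {n : ℕ} (ρ : ℝ) (x y : Fin n → ℝ) : ℝ :=
  ∏ j, (1 + ρ * (x j * y j)) / 2

/-- The noise operator on the cube, multiplying the Fourier coefficient at `S` by `ρ ^ #S`. -/
def noise {E : Type*} [AddCommGroup E] [Module ℝ E] {n : ℕ} (ρ : ℝ) (f : (Fin n → ℝ) → E)
    (x : Fin n → ℝ) : E :=
  ∑ y ∈ cube n, noiseKernel ρ x y • f y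

theorem noiseKernel_comm {n : ℕ} (ρ : ℝ) (x y : Fin n → ℝ) :
    noiseKernel ρ x y = noiseKernel ρ y x :=
  prod_congr rfl fun j _ => by rw [mul_comm (x j)]

theorem noiseKernel_nonneg {n : ℕ} {ρ : ℝ} (hρ : |ρ| ≤ 1) {x y : Fin n → ℝ} (hx : x ∈ cube n)
    (hy : y ∈ cube n) : 0 ≤ noiseKernel ρ x y := by
  refine prod_nonneg fun j _ => ?_
  have h : |x j * y j| ≤ 1 := by
    rw [← sq_le_one_iff_abs_le_one, mul_pow, sq_eq_one_of_mem_cube hx, sq_eq_one_of_mem_cube hy,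
      one_mul]
  have h2 : |ρ * (x j * y j)| ≤ 1 := by
    rw [abs_mul]; exact mul_le_one₀ hρ (abs_nonneg _) h
  linarith [neg_le_of_abs_le h2]

theorem sum_noiseKernel {n : ℕ} (ρ : ℝ) (x : Fin n → ℝ) :
    ∑ y ∈ cube n, noiseKernel ρ x y = 1 := by
  unfold noiseKernel
  rw [sum_cube_prod fun j t => (1 + ρ * (x j * t)) / 2]
  exact prod_eq_one fun j _ => by ring

theorem noise_eq_sum {E : Type*} [AddCommGroup E] [Module ℝ E] {n : ℕ} (ρ : ℝ)
    (f : (Fin n → ℝ) → E) (x : Fin n → ℝ) :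
    noise ρ f x = ∑ S, (ρ ^ #S * ∏ j ∈ S, x j) • cubeFourier n f S := by
  have h : ∀ y : Fin n → ℝ, noiseKernel ρ x y =
      ∑ S : Finset (Fin n), (ρ ^ #S * ∏ j ∈ S, x j) * (((2 : ℝ) ^ n)⁻¹ * ∏ j ∈ S, y j) :=
    fun y => by
      rw [noiseKernel, prod_div_distrib, prod_one_add, powerset_univ, prod_const, card_univ,
        Fintype.card_fin, sum_div]
      refine sum_congr rfl fun S _ => ?_
      rw [prod_mul_distrib, prod_mul_distrib, prod_const]
      ring
  simp only [noise, h, sum_smul, cubeFourier, smul_sum, smul_smul]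
  rw [sum_comm]

theorem sum_cube_norm_noise_sq_le {E : Type*} [NormedAddCommGroup E] [NormedSpace ℝ E] {n : ℕ}
    {ρ : ℝ} (hρ : |ρ| ≤ 1) (f : (Fin n → ℝ) → E) :
    ∑ x ∈ cube n, ‖noise ρ f x‖ ^ 2 ≤ ∑ x ∈ cube n, ‖f x‖ ^ 2 := by
  calc _ ≤ ∑ x ∈ cube n, ∑ y ∈ cube n, noiseKernel ρ x y * ‖f y‖ ^ 2 := by
        refine sum_le_sum fun x hx => ?_
        have habs : ∀ y ∈ cube n, |noiseKernel ρ x y| = noiseKernel ρ x y := fun y hy =>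
          abs_of_nonneg (noiseKernel_nonneg hρ hx hy)
        refine (norm_sum_smul_sq_le _ _ _).trans_eq ?_
        rw [sum_congr rfl habs, sum_noiseKernel, one_mul]
        exact sum_congr rfl fun y hy => by rw [habs y hy]
    _ = _ := by
        rw [sum_comm]
        refine sum_congr rfl fun y _ => ?_
        simp_rw [← sum_mul, noiseKernel_comm ρ _ y, sum_noiseKernel, one_mul]

theorem rad_eq_sum {E : Type*} [AddCommGroup E] [Module ℝ E] {n : ℕ} (f : (Fin n → ℝ) → E)
    (x : Fin n → ℝ) :
    rad n f x = ∑ S, ((if #S = 1 then 1 else 0) * ∏ j ∈ S, x j) • cubeFourier n f S := by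
  simp only [ite_mul, one_mul, zero_mul, ite_smul, zero_smul]
  rw [← sum_filter, rad, univ_filter_card_eq, powersetCard_one, sum_map]
  simp

theorem sum_cube_norm_rad_sq_le {E : Type*} [NormedAddCommGroup E] [NormedSpace ℝ E]
    [FiniteDimensional ℝ E] {n m N : ℕ} (hm : Module.finrank ℝ E = m) (hN : 0 < N)
    (hmN : m ≤ 2 ^ N) (f : (Fin n → ℝ) → E) :
    ∑ x ∈ cube n, ‖rad n f x‖ ^ 2 ≤ (8 * N) ^ 2 * ∑ x ∈ cube n, ‖f x‖ ^ 2 := by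
  obtain ⟨M, w, ρ, hρ, hw, hquad⟩ := exists_quadrature_deriv_zero hN
  set F := ∑ x ∈ cube n, ‖f x‖ ^ 2
  have hF0 : 0 ≤ F := sum_nonneg fun _ _ => sq_nonneg _
  have hW : ∑ j ∈ range M, |2 * w j| ≤ 4 * N := by
    simp_rw [abs_mul, ← mul_sum, abs_two]
    linarith
  have hW0 : 0 ≤ ∑ j ∈ range M, |2 * w j| := sum_nonneg fun _ _ => abs_nonneg _
  have hρ2 : ∀ j, |ρ j / 2| ≤ 1 / 2 := fun j => by
    rw [abs_div, abs_two]; linarith [hρ j]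
  set q : ℕ → ℝ := fun k => ∑ j ∈ range M, 2 * w j * (ρ j / 2) ^ k with hq
  have hq1 : ∀ k ≤ N, q k = if k = 1 then 1 else 0 := fun k hk => by
    have : q k = 2 / 2 ^ k * ∑ j ∈ range M, w j * ρ j ^ k := by
      rw [hq, mul_sum]
      exact sum_congr rfl fun j _ => by rw [div_pow]; ring
    rw [this, hquad k hk]
    split_ifs with h
    · simp [h]
    · simp
  have hq2 : ∀ k, N ≤ k → |q k| ≤ 4 * N * (1 / 2) ^ N := fun k hk => by
    refine (abs_sum_le_sum_abs _ _).trans ?_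
    calc _ ≤ ∑ j ∈ range M, |2 * w j| * (1 / 2) ^ N := by
          gcongr with j _
          rw [abs_mul, abs_pow]
          gcongr
          exact (pow_le_pow_left₀ (abs_nonneg _) (hρ2 j) k).trans
            (pow_le_pow_of_le_one (by norm_num) (by norm_num) hk)
      _ ≤ _ := by rw [← sum_mul]; gcongr
  set c : Finset (Fin n) → ℝ := fun S => (if #S = 1 then 1 else 0) - q #S with hc
  have hcb : ∀ S, |c S| ≤ 4 * N * (1 / 2) ^ N := fun S => by
    rcases le_or_gt #S N with h | h
    · rw [hc]
      simp only [hq1 _ h, sub_self, abs_zero]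
      positivity
    · have : #S ≠ 1 := by omega
      simp only [hc, this, if_false, zero_sub, abs_neg]
      exact hq2 _ h.le
  have hsplit : ∀ x, rad n f x = ∑ j ∈ range M, (2 * w j) • noise (ρ j / 2) f x +
      ∑ S, (c S * ∏ j ∈ S, x j) • cubeFourier n f S := fun x => by
    simp_rw [noise_eq_sum, smul_sum, smul_smul]
    rw [sum_comm, ← sum_add_distrib, rad_eq_sum]
    refine sum_congr rfl fun S _ => ?_
    rw [← sum_smul, ← add_smul]
    congr 1
    simp_rw [← mul_assoc, ← sum_mul, ← add_mul]
    rw [hc]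
    ring
  have hmain : ∑ x ∈ cube n, ‖∑ j ∈ range M, (2 * w j) • noise (ρ j / 2) f x‖ ^ 2 ≤
      (4 * N) ^ 2 * F := by
    calc _ ≤ ∑ x ∈ cube n, (∑ j ∈ range M, |2 * w j|) *
            ∑ j ∈ range M, |2 * w j| * ‖noise (ρ j / 2) f x‖ ^ 2 :=
          sum_le_sum fun x _ => norm_sum_smul_sq_le _ _ _
      _ = (∑ j ∈ range M, |2 * w j|) *
            ∑ j ∈ range M, |2 * w j| * ∑ x ∈ cube n, ‖noise (ρ j / 2) f x‖ ^ 2 := by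
          rw [← mul_sum, sum_comm]
          simp_rw [mul_sum]
      _ ≤ (∑ j ∈ range M, |2 * w j|) * ∑ j ∈ range M, |2 * w j| * F := by
          gcongr with j _
          exact sum_cube_norm_noise_sq_le ((hρ2 j).trans (by norm_num)) f
      _ = (∑ j ∈ range M, |2 * w j|) ^ 2 * F := by rw [← sum_mul]; ring
      _ ≤ _ := by gcongr
  have htail : ∑ x ∈ cube n, ‖∑ S, (c S * ∏ j ∈ S, x j) • cubeFourier n f S‖ ^ 2 ≤
      (4 * N) ^ 2 * F := by
    refine (sum_cube_norm_multiplier_sq_le hm f c hcb).trans ?_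
    gcongr ?_ ^ 2 * _
    have hm' : (m : ℝ) * (1 / 2) ^ N ≤ 1 := by
      rw [one_div, inv_pow, ← div_eq_mul_inv, div_le_one (by positivity)]
      exact_mod_cast hmN
    calc (m : ℝ) * (4 * N * (1 / 2) ^ N) = 4 * N * (m * (1 / 2) ^ N) := by ring
      _ ≤ 4 * N := mul_le_of_le_one_right (by positivity) hm'
  calc _ ≤ ∑ x ∈ cube n, (2 * ‖∑ j ∈ range M, (2 * w j) • noise (ρ j / 2) f x‖ ^ 2 +
          2 * ‖∑ S, (c S * ∏ j ∈ S, x j) • cubeFourier n f S‖ ^ 2) := by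
        refine sum_le_sum fun x _ => ?_
        rw [hsplit x, ← mul_add]
        exact (pow_le_pow_left₀ (norm_nonneg _) (norm_add_le _ _) 2).trans (add_sq_le)
    _ ≤ _ := by
        rw [sum_add_distrib, ← mul_sum, ← mul_sum]
        linarith

theorem sqrt_cubeAvg_norm_rad_sq_le {E : Type*} [NormedAddCommGroup E] [NormedSpace ℝ E]
    [FiniteDimensional ℝ E] {n m : ℕ} (hm : Module.finrank ℝ E = m) (hm1 : 1 ≤ m)
    (f : (Fin n → ℝ) → E) :
    √(cubeAvg n fun x => ‖rad n f x‖ ^ 2) ≤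
      16 / log 2 * log (m + 1) * √(cubeAvg n fun x => ‖f x‖ ^ 2) := by
  have hlog2 : 0 < log 2 := log_pos one_lt_two
  have hm1' : (1 : ℝ) ≤ m := by exact_mod_cast hm1
  set N := Nat.log 2 m + 1 with hN
  have hNlog : 8 * (N : ℝ) ≤ 16 / log 2 * log (m + 1) := by
    have h1 : (Nat.log 2 m : ℝ) * log 2 ≤ log (m + 1) := by
      rw [← log_pow]
      refine log_le_log (by positivity) ?_
      have : ((2 : ℝ) ^ Nat.log 2 m) ≤ m := by
        exact_mod_cast Nat.pow_log_le_self 2 (by omega)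
      linarith
    have h2 : log 2 ≤ log (m + 1) := log_le_log two_pos (by linarith)
    rw [div_mul_eq_mul_div, le_div_iff₀ hlog2, hN]
    push_cast
    linarith
  have h := sum_cube_norm_rad_sq_le hm (Nat.succ_pos _) (Nat.lt_pow_succ_log_self one_lt_two m).le f
  calc _ ≤ √((8 * N) ^ 2 * cubeAvg n fun x => ‖f x‖ ^ 2) := by
        refine sqrt_le_sqrt ?_
        rw [cubeAvg, cubeAvg, ← mul_div_assoc]
        gcongr
    _ = 8 * N * √(cubeAvg n fun x => ‖f x‖ ^ 2) := by
        rw [sqrt_mul (by positivity), sqrt_sq (by positivity)]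
    _ ≤ _ := by gcongr

/-- **Pisier's inequality.** -/
theorem pisier_inequality :
    ∃ C : ℝ, 0 < C ∧
      ∀ (n m : ℕ), 1 ≤ n → 1 ≤ m →
      ∀ N : (Fin m → ℝ) → ℝ,
        (∀ x y, N (x + y) ≤ N x + N y) →
        (∀ (c : ℝ) (x), N (c • x) = |c| * N x) →
        (∀ x, N x = 0 → x = 0) →
        ∀ f : (Fin n → ℝ) → (Fin m → ℝ),
          Real.sqrt (cubeAvg n fun x => (N (rad n f x)) ^ 2) ≤
            C * Real.log (m + 1) *
              Real.sqrt (cubeAvg n fun x => (N (f x)) ^ 2) := by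
  refine ⟨16 / log 2, div_pos (by norm_num) (log_pos one_lt_two), ?_⟩
  intro n m _ hm N hadd hsmul hzero f
  have h0 : N 0 = 0 := by simpa using hsmul 0 0
  have hnonneg : ∀ x, 0 ≤ N x := fun x => by
    have h1 := hadd x ((-1 : ℝ) • x)
    rw [hsmul, neg_one_smul, add_neg_cancel, h0] at h1
    norm_num at h1
    exact h1
  let normInst : Norm (Fin m → ℝ) := ⟨N⟩
  have core : @NormedSpace.Core ℝ (Fin m → ℝ) _ _ _ normInst :=
    @NormedSpace.Core.mk ℝ (Fin m → ℝ) _ _ _ normInst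
      (@SeminormedSpace.Core.mk ℝ (Fin m → ℝ) _ _ normInst _ hnonneg hsmul hadd)
      fun x => ⟨hzero x, fun h => h ▸ h0⟩
  let grp : NormedAddCommGroup (Fin m → ℝ) := @NormedAddCommGroup.ofCore ℝ _ _ _ _ normInst core
  let spc : @NormedSpace ℝ (Fin m → ℝ) _ grp.toSeminormedAddCommGroup :=
    @NormedSpace.ofCore ℝ (Fin m → ℝ) _ grp.toSeminormedAddCommGroup _ core
  have hfin : FiniteDimensional ℝ (Fin m → ℝ) := inferInstance
  have hrank : Module.finrank ℝ (Fin m → ℝ) = m := by simp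
  exact @sqrt_cubeAvg_norm_rad_sq_le (Fin m → ℝ) grp spc hfin n m hrank hm f
end
end

section
/- For every odd integer ℓ > 0, let φ(θ) = ((2ℓ−1)/ℓ)·sin(ℓθ)/sin²(θ). There exists a finitely supported probability distribution on θ ∈ [0, 2π] such that E[φ(θ)·sin^k(θ)] = 1 if k = 1, E[φ(θ)·sin^k(θ)] = 0 for each k ∈ {0, 2, 3, …, ℓ}, and E[|φ(θ)|] ≤ 4ℓ. -/
open Finset Real

noncomputable section

/-- The function `φ(θ) = ((2ℓ−1)/ℓ)·sin(ℓθ)/sin²(θ)`. -/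
def phiFn (ℓ : ℕ) (θ : ℝ) : ℝ :=
  ((2 * (ℓ : ℝ) - 1) / ℓ) * Real.sin (ℓ * θ) / (Real.sin θ) ^ 2

/-- A finitely indexed family of nonnegative weights pushes forward to a weight function on a finite set. -/
lemma exists_finset_weight_of_fintype {ι α : Type*} [Fintype ι] (x : ι → α) (p : ι → ℝ)
    (hp : ∀ i, 0 ≤ p i) :
    ∃ (s : Finset α) (w : α → ℝ), (∀ a ∈ s, ∃ i, x i = a) ∧ (∀ a, 0 ≤ w a) ∧
      ∀ f : α → ℝ, ∑ a ∈ s, w a * f a = ∑ i, p i * f (x i) := by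
  classical
  refine ⟨univ.image x, fun a => ∑ i with x i = a, p i, ?_, ?_, ?_⟩
  · simp
  · exact fun a => sum_nonneg fun i _ => hp i
  · intro f
    rw [← sum_fiberwise_of_maps_to (s := univ) (t := univ.image x) (g := x) (by simp)]
    refine sum_congr rfl fun a _ => ?_
    rw [sum_mul]
    refine sum_congr rfl fun i hi => ?_
    rw [(mem_filter.mp hi).2]

/-- The points where `sin (ℓ θ) = ± 1`. -/
def sinNode (ℓ j : ℕ) : ℝ := (2 * j + 1) * π / (2 * ℓ)

/-- The point of the unit circle with argument `sinNode ℓ j`. -/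
def circleNode (ℓ j : ℕ) : ℂ := Complex.exp (sinNode ℓ j * Complex.I)

section Nodes

variable {ℓ : ℕ}

lemma sinNode_mem_Icc (hℓ : 0 < ℓ) {j : ℕ} (hj : j < 2 * ℓ) :
    sinNode ℓ j ∈ Set.Icc (0 : ℝ) (2 * π) := by
  have hℓ' : (0 : ℝ) < ℓ := by exact_mod_cast hℓ
  have hj' : (j : ℝ) + 1 ≤ 2 * ℓ := by exact_mod_cast hj
  have := Real.pi_pos
  refine ⟨by unfold sinNode; positivity, ?_⟩
  rw [sinNode, div_le_iff₀ (by positivity)]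
  nlinarith

lemma circleNode_ne_zero (ℓ j : ℕ) : circleNode ℓ j ≠ 0 := Complex.exp_ne_zero _

lemma circleNode_pow_two_mul (hℓ : 0 < ℓ) (j : ℕ) : circleNode ℓ j ^ (2 * ℓ) = -1 := by
  have hℓ' : (ℓ : ℂ) ≠ 0 := by exact_mod_cast hℓ.ne'
  rw [circleNode, ← Complex.exp_nat_mul, ← Complex.exp_pi_mul_I,
    Complex.exp_eq_exp_iff_exists_int]
  refine ⟨j, ?_⟩
  simp only [sinNode]
  push_cast
  field_simp
  ring

lemma one_sub_circleNode_sq_ne_zero (hℓ : 0 < ℓ) (j : ℕ) : 1 - circleNode ℓ j ^ 2 ≠ 0 := by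
  intro h
  have h1 := circleNode_pow_two_mul hℓ j
  rw [pow_mul, ← sub_eq_zero.mp h, one_pow] at h1
  norm_num at h1

lemma sin_mul_circleNode (ℓ j : ℕ) :
    (Real.sin (sinNode ℓ j) : ℂ) * circleNode ℓ j =
      Complex.I / 2 * (1 - circleNode ℓ j ^ 2) := by
  have h := circleNode_ne_zero ℓ j
  rw [Complex.ofReal_sin, Complex.sin, neg_mul, Complex.exp_neg]
  change ((circleNode ℓ j)⁻¹ - circleNode ℓ j) * Complex.I / 2 * circleNode ℓ j = _
  field_simp

lemma sin_sinNode_ne_zero (hℓ : 0 < ℓ) (j : ℕ) : Real.sin (sinNode ℓ j) ≠ 0 := by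
  intro h
  have h1 := sin_mul_circleNode ℓ j
  rw [h, Complex.ofReal_zero, zero_mul] at h1
  exact mul_ne_zero (by simp) (one_sub_circleNode_sq_ne_zero hℓ j) h1.symm

lemma sin_mul_sinNode (hℓ : 0 < ℓ) (j : ℕ) :
    (Real.sin (ℓ * sinNode ℓ j) : ℂ) = -Complex.I * circleNode ℓ j ^ ℓ := by
  have h := circleNode_ne_zero ℓ j
  have h1 : (circleNode ℓ j ^ ℓ)⁻¹ = -circleNode ℓ j ^ ℓ := by
    rw [inv_eq_iff_eq_inv, eq_comm, inv_eq_iff_eq_inv, eq_comm]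
    refine inv_eq_of_mul_eq_one_right ?_
    have := circleNode_pow_two_mul hℓ j
    rw [two_mul, pow_add] at this
    linear_combination -this
  have h2 : Complex.exp ((ℓ * sinNode ℓ j : ℂ) * Complex.I) = circleNode ℓ j ^ ℓ := by
    rw [circleNode, ← Complex.exp_nat_mul, mul_assoc]
  rw [Complex.ofReal_sin, Complex.sin, neg_mul, Complex.exp_neg, Complex.ofReal_mul,
    Complex.ofReal_natCast, h2, h1]
  ring

lemma sin_mul_sinNode_sq (hℓ : 0 < ℓ) (j : ℕ) : Real.sin (ℓ * sinNode ℓ j) ^ 2 = 1 := by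
  have h : (Real.sin (ℓ * sinNode ℓ j) : ℂ) ^ 2 = 1 := by
    rw [sin_mul_sinNode hℓ, mul_pow, ← pow_mul, mul_comm ℓ 2, circleNode_pow_two_mul hℓ]
    simp
  exact_mod_cast h

lemma sin_mul_sinNode_div_sin (hℓ : 0 < ℓ) (j : ℕ) :
    ((Real.sin (ℓ * sinNode ℓ j) / Real.sin (sinNode ℓ j) : ℝ) : ℂ) =
      -∑ t ∈ range ℓ, circleNode ℓ j ^ (2 * t + (ℓ + 1)) := by
  have hs : (Real.sin (sinNode ℓ j) : ℂ) ≠ 0 := by exact_mod_cast sin_sinNode_ne_zero hℓ j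
  have hg : (∑ t ∈ range ℓ, (circleNode ℓ j ^ 2) ^ t) * (1 - circleNode ℓ j ^ 2) = 2 := by
    rw [geom_sum_mul_neg, ← pow_mul, circleNode_pow_two_mul hℓ]
    norm_num
  have hsum : ∑ t ∈ range ℓ, circleNode ℓ j ^ (2 * t + (ℓ + 1)) =
      (∑ t ∈ range ℓ, (circleNode ℓ j ^ 2) ^ t) * circleNode ℓ j ^ (ℓ + 1) := by
    rw [sum_mul]
    exact sum_congr rfl fun t _ => by rw [pow_add, pow_mul]
  rw [Complex.ofReal_div, div_eq_iff hs, sin_mul_sinNode hℓ, hsum, pow_succ _ ℓ]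
  generalize ∑ t ∈ range ℓ, (circleNode ℓ j ^ 2) ^ t = G at hg ⊢
  linear_combination G * circleNode ℓ j ^ ℓ * sin_mul_circleNode ℓ j +
    Complex.I / 2 * circleNode ℓ j ^ ℓ * hg

lemma sum_circleNode_pow_eq_zero (hℓ : 0 < ℓ) {r : ℕ} (hr : ¬ 2 * ℓ ∣ r) :
    ∑ j ∈ range (2 * ℓ), circleNode ℓ j ^ r = 0 := by
  have hℓ' : (ℓ : ℂ) ≠ 0 := by exact_mod_cast hℓ.ne'
  have hζ := Complex.isPrimitiveRoot_exp (2 * ℓ) (by lia)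
  set ζ := Complex.exp (2 * π * Complex.I / (2 * ℓ : ℕ)) with hζ_def
  have hne : ζ ^ r ≠ 1 := fun h => hr (hζ.dvd_of_pow_eq_one r h)
  have hj : ∀ j, circleNode ℓ j ^ r = circleNode ℓ 0 ^ r * (ζ ^ r) ^ j := by
    intro j
    have : circleNode ℓ j = circleNode ℓ 0 * ζ ^ j := by
      rw [circleNode, circleNode, hζ_def, ← Complex.exp_nat_mul, ← Complex.exp_add]
      congr 1
      simp only [sinNode]
      push_cast
      field_simp
      ring
    rw [this, mul_pow, ← pow_mul, ← pow_mul, mul_comm j r]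
  have hg : (∑ j ∈ range (2 * ℓ), (ζ ^ r) ^ j) * (ζ ^ r - 1) = 0 := by
    rw [geom_sum_mul, ← pow_mul, mul_comm r, pow_mul, hζ.pow_eq_one, one_pow, sub_self]
  rw [sum_congr rfl fun j _ => hj j, ← mul_sum,
    (mul_eq_zero.mp hg).resolve_right (sub_ne_zero.mpr hne), mul_zero]

lemma sum_circleNode_pow (hℓ : 0 < ℓ) {r : ℕ} (h0 : 0 < r) (hr : r < 4 * ℓ) :
    ∑ j ∈ range (2 * ℓ), circleNode ℓ j ^ r = if r = 2 * ℓ then -(2 * ℓ : ℂ) else 0 := by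
  split_ifs with h
  · simp [h, circleNode_pow_two_mul hℓ]
  · refine sum_circleNode_pow_eq_zero hℓ ?_
    rintro ⟨q, rfl⟩
    have hq : q < 2 := by nlinarith
    interval_cases q <;> lia

lemma sum_sin_mul_sinNode_div_sin (hℓ : 0 < ℓ) (hodd : Odd ℓ) :
    ∑ j ∈ range (2 * ℓ), Real.sin (ℓ * sinNode ℓ j) / Real.sin (sinNode ℓ j) = 2 * ℓ := by
  obtain ⟨m, hm⟩ := hodd
  have h : ∑ j ∈ range (2 * ℓ),
      ((Real.sin (ℓ * sinNode ℓ j) / Real.sin (sinNode ℓ j) : ℝ) : ℂ) = 2 * ℓ := by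
    simp_rw [sin_mul_sinNode_div_sin hℓ, sum_neg_distrib]
    rw [sum_comm, sum_eq_single_of_mem m (by simp; lia)]
    · rw [sum_circleNode_pow hℓ (by lia) (by lia), if_pos (by lia), neg_neg]
    · intro t ht htm
      rw [mem_range] at ht
      rw [sum_circleNode_pow hℓ (by lia) (by lia), if_neg (by lia)]
  exact_mod_cast h

lemma sum_inv_sin_sinNode_sq (hℓ : 0 < ℓ) :
    ∑ j ∈ range (2 * ℓ), (Real.sin (sinNode ℓ j) ^ 2)⁻¹ = 2 * ℓ ^ 2 := by
  have hj : ∀ j, (((Real.sin (sinNode ℓ j) ^ 2)⁻¹ : ℝ) : ℂ) =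
      -∑ t ∈ range ℓ, ∑ u ∈ range ℓ, circleNode ℓ j ^ (2 * t + 2 * u + 2) := by
    intro j
    have h1 : (Real.sin (sinNode ℓ j) ^ 2)⁻¹ =
        (Real.sin (ℓ * sinNode ℓ j) / Real.sin (sinNode ℓ j)) ^ 2 := by
      rw [div_pow, sin_mul_sinNode_sq hℓ, one_div]
    rw [h1, Complex.ofReal_pow, sin_mul_sinNode_div_sin hℓ, neg_sq, sq, sum_mul_sum,
      ← sum_neg_distrib]
    refine sum_congr rfl fun t _ => ?_
    rw [← sum_neg_distrib]
    refine sum_congr rfl fun u _ => ?_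
    rw [← pow_add, show 2 * t + (ℓ + 1) + (2 * u + (ℓ + 1)) = 2 * ℓ + (2 * t + 2 * u + 2) by ring,
      pow_add, circleNode_pow_two_mul hℓ, neg_one_mul]
  have h : ∑ j ∈ range (2 * ℓ), (((Real.sin (sinNode ℓ j) ^ 2)⁻¹ : ℝ) : ℂ) = 2 * ℓ ^ 2 := by
    simp_rw [hj, sum_neg_distrib]
    rw [sum_comm]
    have : ∀ t ∈ range ℓ, ∑ j ∈ range (2 * ℓ), ∑ u ∈ range ℓ,
        circleNode ℓ j ^ (2 * t + 2 * u + 2) = -(2 * ℓ : ℂ) := by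
      intro t ht
      rw [mem_range] at ht
      rw [sum_comm, sum_eq_single_of_mem (ℓ - 1 - t) (by simp; lia)]
      · rw [sum_circleNode_pow hℓ (by lia) (by lia), if_pos (by lia)]
      · intro u hu hne
        rw [mem_range] at hu
        rw [sum_circleNode_pow hℓ (by lia) (by lia), if_neg (by lia)]
    rw [sum_congr rfl this]
    simp
    ring
  exact_mod_cast h

lemma sum_sin_mul_sinNode_mul_sin_pow (hℓ : 0 < ℓ) {m : ℕ} (hm : m < ℓ) :
    ∑ j ∈ range (2 * ℓ), Real.sin (ℓ * sinNode ℓ j) * Real.sin (sinNode ℓ j) ^ m = 0 := by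
  have hj : ∀ j, ((Real.sin (ℓ * sinNode ℓ j) * Real.sin (sinNode ℓ j) ^ m : ℝ) : ℂ) =
      ∑ i ∈ range (m + 1), -Complex.I * (Complex.I / 2) ^ m * ((-1) ^ i * m.choose i) *
        circleNode ℓ j ^ (ℓ - m + 2 * i) := by
    intro j
    have h1 : circleNode ℓ j ^ ℓ = circleNode ℓ j ^ (ℓ - m) * circleNode ℓ j ^ m := by
      rw [← pow_add, Nat.sub_add_cancel hm.le]
    calc ((Real.sin (ℓ * sinNode ℓ j) * Real.sin (sinNode ℓ j) ^ m : ℝ) : ℂ)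
        = -Complex.I * circleNode ℓ j ^ (ℓ - m) *
          (Real.sin (sinNode ℓ j) * circleNode ℓ j) ^ m := by
          rw [Complex.ofReal_mul, Complex.ofReal_pow, sin_mul_sinNode hℓ, h1, mul_pow]
          ring
      _ = -Complex.I * circleNode ℓ j ^ (ℓ - m) *
          ((Complex.I / 2) ^ m * (-circleNode ℓ j ^ 2 + 1) ^ m) := by
          rw [sin_mul_circleNode, mul_pow, sub_eq_neg_add]
      _ = _ := by
          rw [add_pow, mul_sum, mul_sum]
          refine sum_congr rfl fun i _ => ?_
          rw [neg_pow, ← pow_mul, one_pow, pow_add]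
          ring
  have h : ∑ j ∈ range (2 * ℓ),
      ((Real.sin (ℓ * sinNode ℓ j) * Real.sin (sinNode ℓ j) ^ m : ℝ) : ℂ) = 0 := by
    simp_rw [hj]
    rw [sum_comm]
    refine sum_eq_zero fun i hi => ?_
    rw [mem_range] at hi
    rw [← mul_sum, sum_circleNode_pow_eq_zero hℓ, mul_zero]
    exact Nat.not_dvd_of_pos_of_lt (by lia) (by lia)
  exact_mod_cast h

lemma sum_sin_mul_sinNode_div_sin_sq (hℓ : 0 < ℓ) :
    ∑ j ∈ range (2 * ℓ), Real.sin (ℓ * sinNode ℓ j) / Real.sin (sinNode ℓ j) ^ 2 = 0 := by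
  have hℓ' : (ℓ : ℝ) ≠ 0 := by exact_mod_cast hℓ.ne'
  have hrefl := sum_range_reflect
    (fun j => Real.sin (ℓ * sinNode ℓ j) / Real.sin (sinNode ℓ j) ^ 2) (2 * ℓ)
  have hneg : ∀ j ∈ range (2 * ℓ),
      Real.sin (ℓ * sinNode ℓ (2 * ℓ - 1 - j)) / Real.sin (sinNode ℓ (2 * ℓ - 1 - j)) ^ 2 =
        -(Real.sin (ℓ * sinNode ℓ j) / Real.sin (sinNode ℓ j) ^ 2) := by
    intro j hj
    rw [mem_range] at hj
    have h1 : sinNode ℓ (2 * ℓ - 1 - j) = 2 * π - sinNode ℓ j := by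
      have hcast : ((2 * ℓ - 1 - j : ℕ) : ℝ) = 2 * ℓ - 1 - j := by
        rw [Nat.cast_sub (by lia), Nat.cast_sub (by lia)]
        push_cast
        ring
      rw [sinNode, sinNode, hcast]
      field_simp
      ring
    rw [h1, mul_sub, Real.sin_nat_mul_two_pi_sub, Real.sin_two_pi_sub, neg_sq, neg_div]
  rw [sum_congr rfl hneg, sum_neg_distrib] at hrefl
  linarith

end Nodes

/-- A point where `sin` does not vanish but, unless `ℓ = 1`, `sin (ℓ θ)` does. -/
lemma exists_sin_ne_zero_phiFn_eq_zero {ℓ : ℕ} (hℓ : 0 < ℓ) (hodd : Odd ℓ) :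
    ∃ θ ∈ Set.Icc (0 : ℝ) (2 * π), Real.sin θ ≠ 0 ∧ ((ℓ : ℝ) - 1) * phiFn ℓ θ = 0 := by
  have hπ := Real.pi_pos
  rcases eq_or_ne ℓ 1 with rfl | h1
  · exact ⟨π / 2, ⟨by positivity, by linarith⟩, by simp, by simp⟩
  · have h2 : (2 : ℝ) ≤ ℓ := by exact_mod_cast (show 2 ≤ ℓ by lia)
    have hlt : π / ℓ < π := div_lt_self hπ (by linarith)
    refine ⟨π / ℓ, ⟨by positivity, by linarith⟩,
      (Real.sin_pos_of_pos_of_lt_pi (by positivity) hlt).ne', ?_⟩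
    rw [phiFn, mul_div_cancel₀ π (by positivity : (ℓ : ℝ) ≠ 0)]
    simp

/-- There is a finitely supported probability distribution on `[0,2π]`, avoiding
the zeros of `sin`, for which `E[φ(θ)·sin^k(θ)]` is `1` for `k = 1`, vanishes for
`k ∈ {0, 2, 3, …, ℓ}`, and `E[|φ(θ)|] ≤ 4ℓ`. -/
theorem phi_distribution_exists (ℓ : ℕ) (hℓ : 0 < ℓ) (hodd : Odd ℓ) :
    ∃ (s : Finset ℝ) (w : ℝ → ℝ),
      (∀ θ ∈ s, θ ∈ Set.Icc (0 : ℝ) (2 * π)) ∧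
      (∀ θ ∈ s, Real.sin θ ≠ 0) ∧
      (∀ θ ∈ s, 0 ≤ w θ) ∧
      (∑ θ ∈ s, w θ) = 1 ∧
      (∑ θ ∈ s, w θ * (phiFn ℓ θ * Real.sin θ ^ 1)) = 1 ∧
      (∀ k : ℕ, k = 0 ∨ (2 ≤ k ∧ k ≤ ℓ) →
        (∑ θ ∈ s, w θ * (phiFn ℓ θ * Real.sin θ ^ k)) = 0) ∧
      (∑ θ ∈ s, w θ * |phiFn ℓ θ|) ≤ 4 * ℓ := by
  have hℓ' : (1 : ℝ) ≤ ℓ := by exact_mod_cast hℓ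
  have hd : (0 : ℝ) < 2 * ℓ - 1 := by linarith
  obtain ⟨θ₀, hθ₀, hsin₀, hphi₀⟩ := exists_sin_ne_zero_phiFn_eq_zero hℓ hodd
  obtain ⟨s, w, hs, hw, hsum⟩ := exists_finset_weight_of_fintype
    (fun i : Option (Fin (2 * ℓ)) => i.elim θ₀ fun j => sinNode ℓ j)
    (fun i => i.elim (((ℓ : ℝ) - 1) / (2 * ℓ - 1)) fun _ => 1 / (2 * (2 * ℓ - 1)))
    (by
      rintro (_ | _)
      · exact div_nonneg (by linarith) hd.le
      · exact div_nonneg zero_le_one (by linarith))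
  have hsum' : ∀ f : ℝ → ℝ, ∑ θ ∈ s, w θ * f θ = ((ℓ : ℝ) - 1) / (2 * ℓ - 1) * f θ₀ +
      1 / (2 * (2 * ℓ - 1)) * ∑ j ∈ range (2 * ℓ), f (sinNode ℓ j) := by
    intro f
    rw [hsum, Fintype.sum_option, sum_range (n := 2 * ℓ), mul_sum]
    rfl
  have hzero : (ℓ : ℝ) - 1 = 0 ∨ phiFn ℓ θ₀ = 0 := mul_eq_zero.mp hphi₀
  refine ⟨s, w, ?_, ?_, fun θ _ => hw θ, ?_, ?_, ?_, ?_⟩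
  · intro θ hθ
    obtain ⟨_ | j, rfl⟩ := hs θ hθ
    exacts [hθ₀, sinNode_mem_Icc hℓ j.2]
  · intro θ hθ
    obtain ⟨_ | j, rfl⟩ := hs θ hθ
    exacts [hsin₀, sin_sinNode_ne_zero hℓ j]
  · have := hsum' fun _ => 1
    simp only [mul_one, sum_const, card_range, nsmul_eq_mul] at this
    have h1 : 1 / (2 * (2 * (ℓ : ℝ) - 1)) * (2 * ℓ : ℕ) = ℓ / (2 * ℓ - 1) := by
      push_cast
      field_simp
    rw [this, h1, ← add_div, div_eq_one_iff_eq hd.ne']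
    ring
  · have h0 : ((ℓ : ℝ) - 1) / (2 * ℓ - 1) * (phiFn ℓ θ₀ * Real.sin θ₀ ^ 1) = 0 := by
      rcases hzero with h | h <;> simp [h]
    have h1 : ∀ j, phiFn ℓ (sinNode ℓ j) * Real.sin (sinNode ℓ j) ^ 1 =
        (2 * ℓ - 1) / ℓ * (Real.sin (ℓ * sinNode ℓ j) / Real.sin (sinNode ℓ j)) := by
      intro j
      have := sin_sinNode_ne_zero hℓ j
      rw [phiFn]
      field_simp
    rw [hsum' fun θ => phiFn ℓ θ * Real.sin θ ^ 1, h0, zero_add, sum_congr rfl fun j _ => h1 j,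
      ← mul_sum, sum_sin_mul_sinNode_div_sin hℓ hodd]
    field_simp
  · intro k hk
    have h0 : ((ℓ : ℝ) - 1) / (2 * ℓ - 1) * (phiFn ℓ θ₀ * Real.sin θ₀ ^ k) = 0 := by
      rcases hzero with h | h <;> simp [h]
    rw [hsum' fun θ => phiFn ℓ θ * Real.sin θ ^ k, h0, zero_add]
    refine mul_eq_zero_of_right _ ?_
    rcases hk with rfl | ⟨hk2, hkℓ⟩
    · simp_rw [pow_zero, mul_one, phiFn, mul_div_assoc]
      rw [← mul_sum, sum_sin_mul_sinNode_div_sin_sq hℓ, mul_zero]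
    · obtain ⟨m, rfl⟩ := Nat.exists_eq_add_of_le' hk2
      have h1 : ∀ j, phiFn ℓ (sinNode ℓ j) * Real.sin (sinNode ℓ j) ^ (m + 2) =
          (2 * ℓ - 1) / ℓ * (Real.sin (ℓ * sinNode ℓ j) * Real.sin (sinNode ℓ j) ^ m) := by
        intro j
        have := sin_sinNode_ne_zero hℓ j
        rw [phiFn, pow_add]
        field_simp
      rw [sum_congr rfl fun j _ => h1 j, ← mul_sum,
        sum_sin_mul_sinNode_mul_sin_pow hℓ (by lia), mul_zero]
  · have h0 : ((ℓ : ℝ) - 1) / (2 * ℓ - 1) * |phiFn ℓ θ₀| = 0 := by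
      rcases hzero with h | h <;> simp [h]
    have h1 : ∀ j, |phiFn ℓ (sinNode ℓ j)| =
        (2 * ℓ - 1) / ℓ * (Real.sin (sinNode ℓ j) ^ 2)⁻¹ := by
      intro j
      have habs : |Real.sin (ℓ * sinNode ℓ j)| = 1 := by
        rw [← sq_eq_sq₀ (abs_nonneg _) zero_le_one, sq_abs, sin_mul_sinNode_sq hℓ, one_pow]
      rw [phiFn, abs_div, abs_mul, habs, mul_one, abs_of_nonneg (sq_nonneg (Real.sin _)),
        abs_of_pos (div_pos hd (by linarith)), div_eq_mul_inv _ (Real.sin _ ^ 2)]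
    rw [hsum' fun θ => |phiFn ℓ θ|, h0, zero_add, sum_congr rfl fun j _ => h1 j, ← mul_sum,
      sum_inv_sin_sinNode_sq hℓ]
    have : 1 / (2 * (2 * (ℓ : ℝ) - 1)) * ((2 * ℓ - 1) / ℓ * (2 * ℓ ^ 2)) = ℓ := by
      field_simp
    linarith
end
end

section
/- Let ℓ > 0 be an odd integer, let Γ = {2πj/(4ℓ) : j = 0, 1, …, 4ℓ−1}, let θ be uniformly distributed on the set Γ \ {0, π} (of size 4ℓ−2), and let φ(θ) = ((2ℓ−1)/ℓ)·sin(ℓθ)/sin²(θ). Then E[φ(θ)·sin(θ)] = 1. -/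
open Finset Real

noncomputable section

/-- The `4ℓ` equally spaced angles `2πj/(4ℓ)`, `j = 0, …, 4ℓ−1`. -/
def gammaSet (ℓ : ℕ) : Finset ℝ :=
  (Finset.range (4 * ℓ)).image fun j : ℕ => 2 * π * (j : ℝ) / (4 * ℓ)

/-- The angles with the zeros `0, π` of `sin` removed. -/
def gammaSet' (ℓ : ℕ) : Finset ℝ :=
  gammaSet ℓ \ {0, π}

theorem sin_mul_dirichlet_sum (m : ℕ) (θ : ℝ) :
    Real.sin θ * (1 + 2 * ∑ k ∈ Finset.range m, Real.cos (2 * ((k : ℝ) + 1) * θ)) =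
      Real.sin ((2 * (m : ℝ) + 1) * θ) := by
  induction m with
  | zero => simp
  | succ m ih =>
    rw [Finset.sum_range_succ, mul_add 2, ← add_assoc, mul_add, ih]
    have h₁ : (2 * (m : ℝ) + 1) * θ = 2 * ((m : ℝ) + 1) * θ - θ := by ring
    have h₂ : (2 * ((m + 1 : ℕ) : ℝ) + 1) * θ = 2 * ((m : ℝ) + 1) * θ + θ := by
      push_cast; ring
    rw [h₁, h₂, Real.sin_sub, Real.sin_add]
    ring

theorem two_sin_mul_sum_cos (n : ℕ) (a : ℝ) :
    2 * Real.sin a * ∑ j ∈ Finset.range n, Real.cos (2 * a * j) =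
      Real.sin ((2 * (n : ℝ) - 1) * a) + Real.sin a := by
  induction n with
  | zero => simp
  | succ n ih =>
    rw [Finset.sum_range_succ, mul_add, ih]
    have h₁ : (2 * (n : ℝ) - 1) * a = 2 * a * n - a := by ring
    have h₂ : (2 * ((n + 1 : ℕ) : ℝ) - 1) * a = 2 * a * n + a := by
      push_cast; ring
    rw [h₁, h₂, Real.sin_sub, Real.sin_add]
    ring

/-- The angles in `gammaSet ℓ` are distinct. -/
theorem gammaSet_injective {ℓ : ℕ} (hℓ : 0 < ℓ) :
    Function.Injective fun j : ℕ => 2 * π * (j : ℝ) / (4 * ℓ) := by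
  intro i j hij
  have hl : (0 : ℝ) < ℓ := by exact_mod_cast hℓ
  have hpi := Real.pi_pos
  simp only at hij
  field_simp at hij
  exact_mod_cast hij

theorem zero_pi_subset_gammaSet {ℓ : ℕ} (hℓ : 0 < ℓ) : ({0, π} : Finset ℝ) ⊆ gammaSet ℓ := by
  have hl : (0 : ℝ) < ℓ := by exact_mod_cast hℓ
  intro x hx
  simp only [Finset.mem_insert, Finset.mem_singleton] at hx
  rw [gammaSet, Finset.mem_image]
  rcases hx with rfl | rfl
  · exact ⟨0, by simpa using hℓ, by simp⟩
  · refine ⟨2 * ℓ, by rw [Finset.mem_range]; omega, ?_⟩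
    push_cast
    field_simp
    norm_num

theorem card_gammaSet' {ℓ : ℕ} (hℓ : 0 < ℓ) : (gammaSet' ℓ).card = 4 * ℓ - 2 := by
  rw [gammaSet', Finset.card_sdiff_of_subset (zero_pi_subset_gammaSet hℓ), gammaSet,
    Finset.card_image_of_injective _ (gammaSet_injective hℓ), Finset.card_range,
    Finset.card_pair Real.pi_pos.ne]

theorem sum_cos_gammaSet {ℓ k : ℕ} (hk : 0 < k) (hkl : k < 2 * ℓ) :
    ∑ θ ∈ gammaSet ℓ, Real.cos (2 * (k : ℝ) * θ) = 0 := by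
  have hℓ : 0 < ℓ := by omega
  have hl : (0 : ℝ) < ℓ := by exact_mod_cast hℓ
  have hk' : (0 : ℝ) < k := by exact_mod_cast hk
  have hkl' : (k : ℝ) < 2 * ℓ := by exact_mod_cast hkl
  have hpi := Real.pi_pos
  rw [gammaSet, Finset.sum_image (gammaSet_injective hℓ).injOn]
  set a : ℝ := k * π / (2 * ℓ) with ha
  have hsin : 0 < Real.sin a := by
    apply Real.sin_pos_of_pos_of_lt_pi
    · positivity
    · rw [ha, div_lt_iff₀ (by positivity)]
      nlinarith
  have h := two_sin_mul_sum_cos (4 * ℓ) a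
  have hend : (2 * ((4 * ℓ : ℕ) : ℝ) - 1) * a = ((2 * k : ℕ) : ℝ) * (2 * π) - a := by
    rw [ha]; push_cast; field_simp; ring
  rw [hend, Real.sin_nat_mul_two_pi_sub, neg_add_cancel] at h
  have hsum := (mul_eq_zero.mp h).resolve_left (by positivity)
  rw [← hsum]
  refine Finset.sum_congr rfl fun j _ => ?_
  congr 1
  rw [ha]; field_simp; ring

/-- On `gammaSet'` the sine does not vanish. -/
theorem sin_ne_zero_of_mem_gammaSet' {ℓ : ℕ} {θ : ℝ} (hθ : θ ∈ gammaSet' ℓ) :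
    Real.sin θ ≠ 0 := by
  rw [gammaSet', Finset.mem_sdiff, gammaSet, Finset.mem_image] at hθ
  obtain ⟨⟨j, hj, rfl⟩, hne⟩ := hθ
  simp only [Finset.mem_insert, Finset.mem_singleton, not_or] at hne
  have hj := Finset.mem_range.mp hj
  have hl : (0 : ℝ) < ℓ := by
    have : 0 < ℓ := by omega
    exact_mod_cast this
  have hpi := Real.pi_pos
  have hjl : (j : ℝ) < 4 * ℓ := by exact_mod_cast hj
  intro h
  set x : ℝ := 2 * π * (j : ℝ) / (4 * ℓ) with hx
  have hx0 : 0 ≤ x := by positivity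
  have hx2 : x < 2 * π := by
    rw [hx, div_lt_iff₀ (by positivity)]
    nlinarith
  have hxπ : Real.sin (x - π) = 0 := by rw [Real.sin_sub_pi, h, neg_zero]
  have hpos : 0 < x := lt_of_le_of_ne hx0 (Ne.symm hne.1)
  have := (Real.sin_eq_zero_iff_of_lt_of_lt (by linarith) (by linarith)).mp hxπ
  exact hne.2 (by linarith)

/-- For `θ` uniform on `Γ \ {0, π}` (a set of size `4ℓ−2`), `E[φ(θ)·sin(θ)] = 1`. -/
theorem phi_expectation_sin (ℓ : ℕ) (hℓ : 0 < ℓ) (hodd : Odd ℓ) :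
    (gammaSet' ℓ).card = 4 * ℓ - 2 ∧
    (∑ θ ∈ gammaSet' ℓ, phiFn ℓ θ * Real.sin θ) / ((gammaSet' ℓ).card : ℝ) = 1 := by
  refine ⟨card_gammaSet' hℓ, ?_⟩
  obtain ⟨m, rfl⟩ := hodd
  let D : ℝ → ℝ := fun θ => 1 + 2 * ∑ k ∈ Finset.range m, Real.cos (2 * ((k : ℝ) + 1) * θ)
  have hphi : ∀ θ ∈ gammaSet' (2 * m + 1), phiFn (2 * m + 1) θ * Real.sin θ =
      (2 * ((2 * m + 1 : ℕ) : ℝ) - 1) / ((2 * m + 1 : ℕ) : ℝ) * D θ := by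
    intro θ hθ
    have hs := sin_ne_zero_of_mem_gammaSet' hθ
    have hD : Real.sin (((2 * m + 1 : ℕ) : ℝ) * θ) = Real.sin θ * D θ := by
      push_cast
      exact (sin_mul_dirichlet_sum m θ).symm
    rw [phiFn, hD]
    field_simp
  have hfull : ∑ θ ∈ gammaSet (2 * m + 1), D θ = 4 * (2 * m + 1) := by
    simp only [D]
    have hcos : ∑ k ∈ Finset.range m, ∑ θ ∈ gammaSet (2 * m + 1),
        Real.cos (2 * ((k : ℝ) + 1) * θ) = 0 := by
      refine Finset.sum_eq_zero fun k hk => ?_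
      have hk := Finset.mem_range.mp hk
      exact_mod_cast sum_cos_gammaSet (ℓ := 2 * m + 1) (k := k + 1) (by omega) (by omega)
    rw [Finset.sum_add_distrib, ← Finset.mul_sum, Finset.sum_comm, hcos, gammaSet,
      Finset.sum_const, Finset.card_image_of_injective _ (gammaSet_injective hℓ)]
    simp
  have hD0 : D 0 = 2 * m + 1 := by
    simp [D, add_comm]
  have hDπ : D π = 2 * m + 1 := by
    have hcos (k : ℕ) : Real.cos (2 * ((k : ℝ) + 1) * π) = 1 := by
      have h : 2 * ((k : ℝ) + 1) * π = ((k + 1 : ℕ) : ℝ) * (2 * π) := by push_cast; ring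
      rw [h, Real.cos_nat_mul_two_pi]
    simp [D, hcos, add_comm]
  have hsum : ∑ θ ∈ gammaSet' (2 * m + 1), D θ = 2 * (2 * m + 1) := by
    have h := Finset.sum_sdiff (f := D) (zero_pi_subset_gammaSet hℓ)
    rw [hfull, Finset.sum_pair Real.pi_pos.ne, hD0, hDπ] at h
    rw [gammaSet']
    linarith
  have hcard : ((gammaSet' (2 * m + 1)).card : ℝ) = 2 * (4 * m + 1) := by
    rw [card_gammaSet' hℓ, show 4 * (2 * m + 1) - 2 = 2 * (4 * m + 1) by omega]
    push_cast
    ring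
  rw [Finset.sum_congr rfl hphi, ← Finset.mul_sum, hsum, hcard]
  push_cast
  field_simp
  ring
end
end

section
/- Let ℓ > 0 be an odd integer, let Γ = {2πj/(4ℓ) : j = 0, 1, …, 4ℓ−1}, let θ be uniformly distributed on the set Γ \ {0, π} (of size 4ℓ−2), and let φ(θ) = ((2ℓ−1)/ℓ)·sin(ℓθ)/sin²(θ). Then E[|φ(θ)|] ≤ 4ℓ. -/
open Finset Real

noncomputable section

/-- The point `πj/(2ℓ)` of `Γ`. -/
def gammaPoint (ℓ j : ℕ) : ℝ := 2 * π * (j : ℝ) / (4 * ℓ)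

theorem gammaPoint_injective {ℓ : ℕ} (hℓ : 0 < ℓ) : Function.Injective (gammaPoint ℓ) := by
  intro a b h
  have hl : (0 : ℝ) < ℓ := by exact_mod_cast hℓ
  unfold gammaPoint at h
  field_simp at h
  exact_mod_cast h

theorem gammaPoint_zero (ℓ : ℕ) : gammaPoint ℓ 0 = 0 := by simp [gammaPoint]

theorem gammaPoint_two_mul {ℓ : ℕ} (hℓ : 0 < ℓ) : gammaPoint ℓ (2 * ℓ) = π := by
  have hl : (0 : ℝ) < ℓ := by exact_mod_cast hℓ
  unfold gammaPoint
  push_cast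
  field_simp
  norm_num

theorem gammaPoint_add_two_mul {ℓ : ℕ} (hℓ : 0 < ℓ) (j : ℕ) :
    gammaPoint ℓ (j + 2 * ℓ) = gammaPoint ℓ j + π := by
  have hl : (0 : ℝ) < ℓ := by exact_mod_cast hℓ
  unfold gammaPoint
  push_cast
  field_simp
  ring

theorem mul_gammaPoint {ℓ : ℕ} (hℓ : 0 < ℓ) (j : ℕ) : ℓ * gammaPoint ℓ j = j * (π / 2) := by
  have hl : (0 : ℝ) < ℓ := by exact_mod_cast hℓ
  unfold gammaPoint
  field_simp
  ring

theorem gammaSet'_eq_image {ℓ : ℕ} (hℓ : 0 < ℓ) :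
    gammaSet' ℓ = (range (4 * ℓ) \ {0, 2 * ℓ}).image (gammaPoint ℓ) := by
  rw [Finset.image_sdiff _ _ (gammaPoint_injective hℓ), Finset.image_insert,
    Finset.image_singleton, gammaPoint_zero, gammaPoint_two_mul hℓ]
  rfl

theorem sum_gammaSet' {ℓ : ℕ} (hℓ : 0 < ℓ) :
    ∑ θ ∈ gammaSet' ℓ, |phiFn ℓ θ| = ∑ j ∈ range (4 * ℓ), |phiFn ℓ (gammaPoint ℓ j)| := by
  rw [gammaSet'_eq_image hℓ, sum_image (gammaPoint_injective hℓ).injOn]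
  refine sum_subset sdiff_subset fun j hj hj' => ?_
  have h : j = 0 ∨ j = 2 * ℓ := by
    simp only [mem_sdiff, mem_insert, mem_singleton] at hj'
    tauto
  rcases h with rfl | rfl
  · simp [gammaPoint_zero, phiFn]
  · simp [gammaPoint_two_mul hℓ, phiFn]

theorem phiFn_gammaPoint_even {ℓ : ℕ} (hℓ : 0 < ℓ) (k : ℕ) :
    phiFn ℓ (gammaPoint ℓ (2 * k)) = 0 := by
  have h : ((2 * k : ℕ) : ℝ) * (π / 2) = k * π := by push_cast; ring
  simp [phiFn, mul_gammaPoint hℓ, h, -Nat.cast_mul]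

theorem abs_phiFn_gammaPoint_odd {ℓ : ℕ} (hℓ : 0 < ℓ) (k : ℕ) :
    |phiFn ℓ (gammaPoint ℓ (2 * k + 1))| =
      (2 * ℓ - 1) / ℓ / sin (gammaPoint ℓ (2 * k + 1)) ^ 2 := by
  have hl : (1 : ℝ) ≤ ℓ := by exact_mod_cast hℓ
  have h : ((2 * k + 1 : ℕ) : ℝ) * (π / 2) = π / 2 + k * π := by push_cast; ring
  have h1 : |sin (π / 2 + k * π)| = 1 := by
    rw [sin_add_nat_mul_pi, sin_pi_div_two, mul_one, abs_pow, abs_neg, abs_one, one_pow]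
  have h2 : (0 : ℝ) ≤ (2 * ℓ - 1) / ℓ := div_nonneg (by linarith) (by linarith)
  rw [phiFn, mul_gammaPoint hℓ, h, abs_div, abs_mul, h1, mul_one, abs_of_nonneg h2,
    abs_of_nonneg (sq_nonneg _)]

theorem sum_range_two_mul (f : ℕ → ℝ) (n : ℕ) :
    ∑ j ∈ range (2 * n), f j = ∑ k ∈ range n, (f (2 * k) + f (2 * k + 1)) := by
  induction n with
  | zero => simp
  | succ n ih => rw [sum_range_succ, ← ih, Nat.mul_succ, sum_range_succ, sum_range_succ, add_assoc]

theorem sum_inv_odd_sq_le (n : ℕ) :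
    ∑ k ∈ range n, (1 : ℝ) / (2 * k + 1) ^ 2 ≤ 2 - 2 / ((n : ℝ) + 1) := by
  induction n with
  | zero => simp
  | succ n ih =>
    rw [sum_range_succ]
    have h : (1 : ℝ) / (2 * n + 1) ^ 2 ≤ 2 / (n + 1) - 2 / (n + 1 + 1) := by
      rw [div_sub_div _ _ (by positivity) (by positivity),
        div_le_div_iff₀ (by positivity) (by positivity)]
      have : (0 : ℝ) ≤ n := n.cast_nonneg
      nlinarith
    push_cast
    linarith

theorem one_div_sin_sq_le {x : ℝ} (hx : 0 < x) (hx' : x ≤ π / 2) :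
    1 / sin x ^ 2 ≤ 1 / (2 / π * x) ^ 2 := by
  have h := mul_le_sin hx.le hx'
  have h0 : 0 < 2 / π * x := by positivity
  gcongr

/-- Jordan's inequality, applied on the half of `(0, π)` that contains the angle. -/
theorem one_div_sin_gammaPoint_sq_le {ℓ k : ℕ} (hk : k < ℓ) :
    1 / sin (gammaPoint ℓ (2 * k + 1)) ^ 2 ≤
      (ℓ : ℝ) ^ 2 * (1 / (2 * k + 1) ^ 2 + 1 / (2 * ((ℓ - 1 - k : ℕ) : ℝ) + 1) ^ 2) := by
  obtain ⟨m, rfl⟩ : ∃ m, ℓ = k + m + 1 := ⟨ℓ - 1 - k, by omega⟩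
  rw [show k + m + 1 - 1 - k = m by omega]
  have hk0 : (0 : ℝ) ≤ k := k.cast_nonneg
  have hm0 : (0 : ℝ) ≤ m := m.cast_nonneg
  have hpi := pi_pos
  set L : ℝ := ((k + m + 1 : ℕ) : ℝ) with hL
  have hL' : L = k + m + 1 := by rw [hL]; push_cast; ring
  have hL0 : 0 < L := by rw [hL']; positivity
  have key : ∀ a : ℕ, (2 * (a : ℝ) + 1) ≤ L →
      1 / sin (π * (2 * a + 1) / (2 * L)) ^ 2 ≤ L ^ 2 * (1 / (2 * a + 1) ^ 2) := by
    intro a ha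
    have ha0 : (0 : ℝ) ≤ a := a.cast_nonneg
    refine (one_div_sin_sq_le (by positivity) ?_).trans_eq ?_
    · rw [div_le_div_iff₀ (by positivity) (by positivity)]
      nlinarith
    · field_simp
  have hx : gammaPoint (k + m + 1) (2 * k + 1) = π * (2 * k + 1) / (2 * L) := by
    rw [gammaPoint, ← hL]
    push_cast
    field_simp
    norm_num
  rw [hx, mul_add (L ^ 2)]
  rcases le_total k m with h | h
  · have h' : (k : ℝ) ≤ m := by exact_mod_cast h
    have := key k (by linarith)
    have h2 : 0 ≤ L ^ 2 * (1 / (2 * (m : ℝ) + 1) ^ 2) := by positivity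
    linarith
  · have h' : (m : ℝ) ≤ k := by exact_mod_cast h
    have := key m (by linarith)
    have h2 : 0 ≤ L ^ 2 * (1 / (2 * (k : ℝ) + 1) ^ 2) := by positivity
    have h3 : π * (2 * k + 1) / (2 * L) = π - π * (2 * m + 1) / (2 * L) := by
      field_simp
      rw [hL']
      ring
    rw [h3, sin_pi_sub]
    linarith

theorem sum_one_div_sin_gammaPoint_sq_le (ℓ : ℕ) :
    ∑ k ∈ range ℓ, 1 / sin (gammaPoint ℓ (2 * k + 1)) ^ 2 ≤ 4 * (ℓ : ℝ) ^ 2 := by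
  have h := sum_inv_odd_sq_le ℓ
  have h0 : (0 : ℝ) ≤ 2 / (ℓ + 1) := by positivity
  calc ∑ k ∈ range ℓ, 1 / sin (gammaPoint ℓ (2 * k + 1)) ^ 2
      ≤ ∑ k ∈ range ℓ, (ℓ : ℝ) ^ 2 *
          (1 / (2 * k + 1) ^ 2 + 1 / (2 * ((ℓ - 1 - k : ℕ) : ℝ) + 1) ^ 2) :=
        sum_le_sum fun k hk => one_div_sin_gammaPoint_sq_le (Finset.mem_range.1 hk)
    _ = (ℓ : ℝ) ^ 2 * (2 * ∑ k ∈ range ℓ, (1 : ℝ) / (2 * k + 1) ^ 2) := by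
        rw [← mul_sum, sum_add_distrib,
          sum_range_reflect (fun k : ℕ => (1 : ℝ) / (2 * k + 1) ^ 2) ℓ, two_mul]
    _ ≤ (ℓ : ℝ) ^ 2 * 4 := by
        gcongr
        linarith
    _ = 4 * (ℓ : ℝ) ^ 2 := mul_comm _ _

theorem sum_abs_phiFn {ℓ : ℕ} (hℓ : 0 < ℓ) :
    ∑ θ ∈ gammaSet' ℓ, |phiFn ℓ θ| =
      2 * ((2 * ℓ - 1) / ℓ * ∑ k ∈ range ℓ, 1 / sin (gammaPoint ℓ (2 * k + 1)) ^ 2) := by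
  rw [sum_gammaSet' hℓ, show 4 * ℓ = 2 * (ℓ + ℓ) by ring, sum_range_two_mul, sum_range_add,
    two_mul (_ * _), mul_sum]
  congr 1 <;> refine sum_congr rfl fun k _ => ?_
  · rw [phiFn_gammaPoint_even hℓ, abs_phiFn_gammaPoint_odd hℓ, abs_zero, zero_add, mul_one_div]
  · rw [phiFn_gammaPoint_even hℓ, abs_phiFn_gammaPoint_odd hℓ, abs_zero, zero_add, mul_one_div,
      show 2 * (ℓ + k) + 1 = 2 * k + 1 + 2 * ℓ by ring, gammaPoint_add_two_mul hℓ, sin_add_pi,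
      neg_sq]

/-- For `θ` uniform on `Γ \ {0, π}` (a set of size `4ℓ−2`), `E[|φ(θ)|] ≤ 4ℓ`. -/
theorem phi_abs_expectation (ℓ : ℕ) (hℓ : 0 < ℓ) (hodd : Odd ℓ) :
    (gammaSet' ℓ).card = 4 * ℓ - 2 ∧
    (∑ θ ∈ gammaSet' ℓ, |phiFn ℓ θ|) / ((gammaSet' ℓ).card : ℝ) ≤ 4 * ℓ := by
  refine ⟨card_gammaSet' hℓ, ?_⟩
  have hl : (1 : ℝ) ≤ ℓ := by exact_mod_cast hℓ
  have hcard : ((gammaSet' ℓ).card : ℝ) = 4 * ℓ - 2 := by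
    rw [card_gammaSet' hℓ, Nat.cast_sub (by omega)]
    push_cast
    ring
  rw [hcard, div_le_iff₀ (by linarith), sum_abs_phiFn hℓ]
  have h0 : (0 : ℝ) ≤ (2 * ℓ - 1) / ℓ := div_nonneg (by linarith) (by linarith)
  calc _ ≤ 2 * ((2 * (ℓ : ℝ) - 1) / ℓ * (4 * (ℓ : ℝ) ^ 2)) := by
        gcongr
        exact sum_one_div_sin_gammaPoint_sq_le ℓ
    _ = 4 * ℓ * (4 * ℓ - 2) := by
        field_simp
        ring
end
end

section
/- There are constants C, c > 0 such that for every n ∈ ℕ with n ≥ 1 there is a function F : {-1,1}^n → ℝ with the following properties: (A) |F(x)| ≤ C for all x ∈ {-1,1}^n; (B) F̂({j}) = 1/√n for all j ∈ [n]; (C) the Fourier sparsity ‖F̂‖₀ (the number of sets S ⊆ [n] with F̂(S) ≠ 0) is at most 2^{c·√n·log n}. -/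
open Finset Real

noncomputable section

open scoped Classical in
/-- The Fourier sparsity `‖f̂‖₀`: the number of sets `S ⊆ [n]` with `f̂(S) ≠ 0`. -/
def sparsity (n : ℕ) (f : (Fin n → ℝ) → ℝ) : ℕ :=
  (Finset.univ.filter fun S : Finset (Fin n) => cubeFourier n f S ≠ 0).card

/-- The Fourier coefficients of a multilinear polynomial are its coefficients. -/
theorem cubeFourier_sum_mul_prod (n : ℕ) (a : Finset (Fin n) → ℝ) (S : Finset (Fin n)) :
    cubeFourier n (fun x => ∑ T, a T * ∏ j ∈ T, x j) S = a S := by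
  have orth (T : Finset (Fin n)) :
      ∑ x ∈ cube n, (∏ j ∈ S, x j) * ∏ j ∈ T, x j = if T = S then 2 ^ n else 0 := by
    have key : ∑ x ∈ cube n, (∏ j ∈ S, x j) * ∏ j ∈ T, x j =
        ∏ j : Fin n, ∑ v ∈ ({-1, 1} : Finset ℝ),
          (if j ∈ S then v else 1) * (if j ∈ T then v else 1) := by
      rw [Finset.prod_univ_sum, cube]
      refine Finset.sum_congr rfl fun x _ => ?_
      rw [Finset.prod_mul_distrib, Fintype.prod_ite_mem, Fintype.prod_ite_mem]
    have hne : (-1 : ℝ) ∉ ({1} : Finset ℝ) := by norm_num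
    rw [key]
    split_ifs with h
    · subst h
      rw [Finset.prod_congr rfl (g := fun _ => (2 : ℝ)), Finset.prod_const, Finset.card_univ,
        Fintype.card_fin]
      intro j _
      rw [Finset.sum_insert hne, Finset.sum_singleton]
      split_ifs <;> norm_num
    · obtain ⟨j, hj⟩ : ∃ j, ¬(j ∈ T ↔ j ∈ S) := by
        by_contra! h'
        exact h (Finset.ext h')
      refine Finset.prod_eq_zero (Finset.mem_univ j) ?_
      rw [Finset.sum_insert hne, Finset.sum_singleton]
      by_cases hS : j ∈ S <;> by_cases hT : j ∈ T <;> simp_all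
  have h2 : ((2 : ℝ) ^ n) ≠ 0 := by positivity
  simp only [cubeFourier, smul_eq_mul, Finset.mul_sum]
  rw [Finset.sum_comm]
  simp_rw [← Finset.mul_sum, mul_left_comm _ (a _), ← Finset.mul_sum, orth]
  simp only [Finset.sum_ite_eq', mul_ite, mul_zero, Finset.mem_univ, if_true]
  field_simp

theorem sum_pow_card_le_exp (n : ℕ) {q : ℝ} (hq : 0 ≤ q) :
    ∑ S : Finset (Fin n), q ^ #S ≤ exp (q * n) := by
  have h : ∑ S : Finset (Fin n), q ^ #S = (1 + q) ^ n := by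
    have := Finset.prod_one_add (f := fun _ : Fin n => q) Finset.univ
    simpa using this.symm
  rw [h, mul_comm, Real.exp_nat_mul]
  gcongr
  linarith [Real.add_one_le_exp q]

/-- A tail of the expansion of `(1 + r) ^ n`, bounded by exponential tilting. -/
theorem sum_pow_card_tail_le (n : ℕ) {r : ℝ} (hr : 0 ≤ r) (t : ℝ) :
    ∑ S : Finset (Fin n) with t < #S, r ^ #S ≤ exp (exp 1 * r * n - t) := by
  calc ∑ S : Finset (Fin n) with t < #S, r ^ #S
      ≤ ∑ S : Finset (Fin n) with t < #S, exp (-t) * (exp 1 * r) ^ #S := by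
        refine Finset.sum_le_sum fun S hS => ?_
        have h1 : 1 ≤ exp (-t) * exp 1 ^ #S := by
          rw [← Real.exp_nat_mul, ← Real.exp_add]
          exact Real.one_le_exp (by linarith [(Finset.mem_filter.mp hS).2])
        rw [mul_pow, ← mul_assoc]
        exact le_mul_of_one_le_left (by positivity) h1
    _ ≤ ∑ S : Finset (Fin n), exp (-t) * (exp 1 * r) ^ #S :=
        Finset.sum_le_sum_of_subset_of_nonneg (Finset.filter_subset _ _)
          fun _ _ _ => by positivity
    _ ≤ exp (-t) * exp (exp 1 * r * n) := by
        rw [← Finset.mul_sum]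
        gcongr
        exact sum_pow_card_le_exp n (by positivity)
    _ = exp (exp 1 * r * n - t) := by
        rw [← Real.exp_add]
        ring_nf

theorem card_filter_card_le_le_exp {n : ℕ} (hn : 1 ≤ n) (t : ℝ) :
    (#{S : Finset (Fin n) | (#S : ℝ) ≤ t} : ℝ) ≤ exp (1 + t * Real.log n) := by
  have hn0 : (0 : ℝ) < n := by exact_mod_cast hn
  have hlog : 0 ≤ Real.log n := Real.log_natCast_nonneg n
  calc (#{S : Finset (Fin n) | (#S : ℝ) ≤ t} : ℝ)
      = ∑ S : Finset (Fin n) with (#S : ℝ) ≤ t, (1 : ℝ) := by simp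
    _ ≤ ∑ S : Finset (Fin n) with (#S : ℝ) ≤ t, exp (t * Real.log n) * (n : ℝ)⁻¹ ^ #S := by
        refine Finset.sum_le_sum fun S hS => ?_
        have h : (n : ℝ)⁻¹ ^ #S = exp (-(#S * Real.log n)) := by
          rw [Real.exp_neg, Real.exp_nat_mul, Real.exp_log hn0, inv_pow]
        rw [h, ← Real.exp_add]
        refine Real.one_le_exp ?_
        nlinarith [(Finset.mem_filter.mp hS).2]
    _ ≤ ∑ S : Finset (Fin n), exp (t * Real.log n) * (n : ℝ)⁻¹ ^ #S :=
        Finset.sum_le_sum_of_subset_of_nonneg (Finset.filter_subset _ _)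
          fun _ _ _ => by positivity
    _ ≤ exp (t * Real.log n) * exp ((n : ℝ)⁻¹ * n) := by
        rw [← Finset.mul_sum]
        gcongr
        exact sum_pow_card_le_exp n (by positivity)
    _ = exp (1 + t * Real.log n) := by
        rw [inv_mul_cancel₀ hn0.ne', ← Real.exp_add, add_comm]

/-- The Fourier coefficients of the imaginary part of the Riesz product `∏ j, (1 + i r x j)`. -/
def rieszCoeff (r : ℝ) (k : ℕ) : ℝ :=
  ((Complex.I * r) ^ k).im

theorem abs_rieszCoeff_le {r : ℝ} (hr : 0 ≤ r) (k : ℕ) : |rieszCoeff r k| ≤ r ^ k := by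
  refine (Complex.abs_im_le_norm _).trans_eq ?_
  rw [norm_pow, norm_mul, Complex.norm_I, one_mul, Complex.norm_of_nonneg hr]

theorem abs_prod_eq_one {n : ℕ} {x : Fin n → ℝ} (hx : x ∈ cube n) (S : Finset (Fin n)) :
    |∏ j ∈ S, x j| = 1 := by
  rw [Finset.abs_prod]
  refine Finset.prod_eq_one fun j _ => ?_
  have hj : x j ∈ ({-1, 1} : Finset ℝ) := Fintype.mem_piFinset.mp hx j
  rw [Finset.mem_insert, Finset.mem_singleton] at hj
  rcases hj with h | h <;> simp [h]

theorem sum_rieszCoeff_mul_prod {n : ℕ} (r : ℝ) (x : Fin n → ℝ) :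
    ∑ S : Finset (Fin n), rieszCoeff r #S * ∏ j ∈ S, x j =
      (∏ j, (1 + Complex.I * r * x j)).im := by
  rw [Finset.prod_one_add, Finset.powerset_univ, Complex.im_sum]
  refine Finset.sum_congr rfl fun S _ => ?_
  rw [Finset.prod_mul_distrib, Finset.prod_const, ← Complex.ofReal_prod, Complex.im_mul_ofReal,
    rieszCoeff]

theorem abs_sum_rieszCoeff_mul_prod_le {n : ℕ} (r : ℝ) {x : Fin n → ℝ} (hx : x ∈ cube n) :
    |∑ S : Finset (Fin n), rieszCoeff r #S * ∏ j ∈ S, x j| ≤ exp (n * r ^ 2) := by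
  rw [sum_rieszCoeff_mul_prod]
  refine (Complex.abs_im_le_norm _).trans ?_
  rw [norm_prod, Real.exp_nat_mul]
  refine (Finset.prod_le_prod (g := fun _ => exp (r ^ 2)) (fun _ _ => norm_nonneg _)
    fun j _ => ?_).trans_eq (by simp)
  have hj : x j ^ 2 = 1 := by
    have := abs_prod_eq_one hx {j}
    rw [Finset.prod_singleton] at this
    rw [← sq_abs, this, one_pow]
  have h1 : 1 + r ^ 2 ≤ exp (r ^ 2) := by linarith [Real.add_one_le_exp (r ^ 2)]
  refine le_trans ?_ h1
  refine le_of_sq_le_sq ?_ (by positivity)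
  have h2 : ‖1 + Complex.I * r * x j‖ ^ 2 = 1 + r ^ 2 := by
    rw [← Complex.normSq_eq_norm_sq, Complex.normSq_apply]
    simp
    linear_combination r ^ 2 * hj
  rw [h2]
  nlinarith [sq_nonneg r]

/-- **Bourgain-type example**: a bounded function with large linear Fourier
coefficients and quasipolynomial Fourier sparsity. -/
theorem bounded_function_with_sparse_fourier :
    ∃ C : ℝ, 0 < C ∧ ∃ c : ℝ, 0 < c ∧
      ∀ n : ℕ, 1 ≤ n →
        ∃ F : (Fin n → ℝ) → ℝ,
          (∀ x ∈ cube n, |F x| ≤ C) ∧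
          (∀ j : Fin n, cubeFourier n F {j} = 1 / Real.sqrt n) ∧
          (sparsity n F : ℝ) ≤ (2 : ℝ) ^ (c * Real.sqrt n * Real.log n) := by
  classical
  refine ⟨exp 1 + 1, by positivity, 8, by norm_num, fun n hn => ?_⟩
  have hn0 : (0 : ℝ) < n := by exact_mod_cast hn
  have hs : 1 ≤ √(n : ℝ) := Real.one_le_sqrt.mpr (by exact_mod_cast hn)
  have hsq : √(n : ℝ) ^ 2 = n := Real.sq_sqrt hn0.le
  set s : ℝ := √(n : ℝ) with hs_def
  have hs0 : 0 < s := by linarith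
  set a : Finset (Fin n) → ℝ := fun S => if (#S : ℝ) ≤ 3 * s then rieszCoeff s⁻¹ #S else 0
    with ha
  refine ⟨fun x => ∑ S, a S * ∏ j ∈ S, x j, fun x hx => ?_, fun j => ?_, ?_⟩
  · have hsplit : ∑ S, a S * ∏ j ∈ S, x j =
        ∑ S : Finset (Fin n), rieszCoeff s⁻¹ #S * ∏ j ∈ S, x j -
          ∑ S : Finset (Fin n) with 3 * s < #S, rieszCoeff s⁻¹ #S * ∏ j ∈ S, x j := by
      rw [Finset.sum_filter, ← Finset.sum_sub_distrib]
      refine Finset.sum_congr rfl fun S _ => ?_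
      by_cases h : (#S : ℝ) ≤ 3 * s
      · simp [ha, h, not_lt.mpr h]
      · simp [ha, h, not_le.mp h]
    have hmain := abs_sum_rieszCoeff_mul_prod_le s⁻¹ hx
    rw [inv_pow, hsq, mul_inv_cancel₀ hn0.ne'] at hmain
    have htail : |∑ S : Finset (Fin n) with 3 * s < #S, rieszCoeff s⁻¹ #S * ∏ j ∈ S, x j| ≤ 1 :=
      calc _ ≤ ∑ S : Finset (Fin n) with 3 * s < #S, |rieszCoeff s⁻¹ #S * ∏ j ∈ S, x j| :=
            Finset.abs_sum_le_sum_abs _ _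
        _ ≤ ∑ S : Finset (Fin n) with 3 * s < #S, s⁻¹ ^ #S := by
            refine Finset.sum_le_sum fun S _ => ?_
            rw [abs_mul, abs_prod_eq_one hx, mul_one]
            exact abs_rieszCoeff_le (by positivity) _
        _ ≤ exp (exp 1 * s⁻¹ * n - 3 * s) := sum_pow_card_tail_le n (by positivity) _
        _ ≤ 1 := by
            have h : exp 1 * s⁻¹ * n = exp 1 * s := by
              rw [← hsq]
              field_simp
            rw [h, Real.exp_le_one_iff]
            nlinarith [Real.exp_one_lt_three]
    simp only [hsplit]
    exact (abs_sub _ _).trans (add_le_add hmain htail)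
  · rw [cubeFourier_sum_mul_prod]
    have h : (1 : ℝ) ≤ 3 * s := by linarith
    simp [ha, h, rieszCoeff]
  · have hsp : sparsity n (fun x => ∑ S, a S * ∏ j ∈ S, x j) = #{S | a S ≠ 0} := by
      simp only [sparsity, cubeFourier_sum_mul_prod]
    rw [hsp]
    obtain rfl | hn2 : n = 1 ∨ 2 ≤ n := by omega
    · have hsub : ({S | a S ≠ 0} : Finset (Finset (Fin 1))) ⊆ {{0}} := by
        intro S hS
        have hne : S ≠ ∅ := by
          rintro rfl
          simp [ha, rieszCoeff] at hS
        rw [Finset.mem_singleton]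
        revert hne
        clear hS
        revert S
        decide
      have := Finset.card_le_card hsub
      simpa using this
    · have hlog : Real.log 2 ≤ Real.log n :=
        Real.log_le_log (by norm_num) (by exact_mod_cast hn2)
      have hsub : ({S | a S ≠ 0} : Finset (Finset (Fin n))) ⊆
          ({S | (#S : ℝ) ≤ 3 * s} : Finset (Finset (Fin n))) :=
        Finset.monotone_filter_right _ fun S _ hS => (ite_ne_right_iff.mp hS).1
      calc (#{S | a S ≠ 0} : ℝ) ≤ #{S : Finset (Fin n) | (#S : ℝ) ≤ 3 * s} := by
            exact_mod_cast Finset.card_le_card hsub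
        _ ≤ exp (1 + 3 * s * Real.log n) := card_filter_card_le_le_exp hn _
        _ ≤ (2 : ℝ) ^ (8 * s * Real.log n) := by
            rw [Real.rpow_def_of_pos (by norm_num), Real.exp_le_exp]
            have h2 := Real.log_two_gt_d9
            have h3 : 0.69 ≤ s * Real.log n := by nlinarith
            nlinarith
end
end

section
/- For every n ≥ 1, the function H : {-1,1}^n → ℝ defined by H(x) = Im(∏_{j=1}^n (1 + (i/√n)·x_j)) satisfies |H(x)| ≤ 3 for all x ∈ {-1,1}^n. -/
open Finset Real

noncomputable section

/-- The function `H(x) = Im(∏_j (1 + (i/√n)·x_j))`. -/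
def Hfun (n : ℕ) (x : Fin n → ℝ) : ℝ :=
  (∏ j : Fin n, (1 + (Complex.I / (Real.sqrt n : ℂ)) * (x j : ℂ))).im

/-- On the cube, the product defining `Hfun` has squared norm `(1 + 1/n)^n`. -/
theorem norm_sq_prod_one_add_I_div_sqrt (n : ℕ) {x : Fin n → ℝ} (hx : x ∈ cube n) :
    ‖∏ j : Fin n, (1 + (Complex.I / (Real.sqrt n : ℂ)) * (x j : ℂ))‖ ^ 2 =
      (1 + 1 / (n : ℝ)) ^ n := by
  have hfactor : ∀ j : Fin n,
      ‖1 + (Complex.I / (Real.sqrt n : ℂ)) * (x j : ℂ)‖ ^ 2 = 1 + 1 / (n : ℝ) := by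
    intro j
    have hsq : x j ^ 2 = 1 := by
      have hj := Fintype.mem_piFinset.mp hx j
      simp only [Finset.mem_insert, Finset.mem_singleton] at hj
      rcases hj with h | h <;> simp [h]
    have hform : 1 + (Complex.I / (Real.sqrt n : ℂ)) * (x j : ℂ) =
        ((1 : ℝ) : ℂ) + ((x j / Real.sqrt n : ℝ) : ℂ) * Complex.I := by
      push_cast
      ring
    rw [hform, Complex.sq_norm, Complex.normSq_add_mul_I, div_pow, hsq,
      Real.sq_sqrt (Nat.cast_nonneg n), one_pow]
  rw [norm_prod, ← Finset.prod_pow, Finset.prod_congr rfl fun j _ => hfactor j]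
  simp

/-- `|H(x)| ≤ 3` on the discrete cube. -/
theorem Hfun_bounded (n : ℕ) (hn : 1 ≤ n) :
    ∀ x ∈ cube n, |Hfun n x| ≤ 3 := by
  intro x hx
  have hn' : (n : ℝ) ≠ 0 := by positivity
  refine (Complex.abs_im_le_norm _).trans (abs_le_of_sq_le_sq' ?_ (by norm_num)).2
  rw [norm_sq_prod_one_add_I_div_sqrt n hx]
  calc (1 + 1 / (n : ℝ)) ^ n ≤ Real.exp (1 / n) ^ n := by
        gcongr
        linarith [Real.add_one_le_exp (1 / (n : ℝ))]
    _ = Real.exp 1 := by rw [← Real.exp_nat_mul, mul_one_div_cancel hn']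
    _ ≤ 3 ^ 2 := by linarith [Real.exp_one_lt_d9]
end
end
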